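/- There exists a finite Galois extension K of ℚ, ramified only at 3, whose Galois group Gal(K/ℚ) is isomorphic to a semidirect product (PSL₂(F₃))⁹ ⋊ ℤ/18ℤ for some action of ℤ/18ℤ on the direct product of 9 copies of PSL₂(F₃); this group is solvable. -/

import Mathlib

/-- `PSL₂(F)`: the quotient of `SL₂(F)` by its center. -/
abbrev PSL2 (F : Type) [Field F] : Type :=
  (Matrix.SpecialLinearGroup (Fin 2) F) ⧸ Subgroup.center (Matrix.SpecialLinearGroup (Fin 2) F)

namespace PSLTwoThree

open Equiv.Perm

/-- The index of the point of `ℙ¹(𝔽₃)` spanned by `(x, y)`, the points being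
listed as `[1 : 0], [0 : 1], [1 : 1], [1 : 2]`. -/
def pointIdx (v : ZMod 3 × ZMod 3) : Fin 4 :=
  if v.2 = 0 then 0 else if v.1 = 0 then 1 else if v.1 = v.2 then 2 else 3

/-- A vector spanning the point of `ℙ¹(𝔽₃)` with a given index. -/
def pointRep (i : Fin 4) : ZMod 3 × ZMod 3 := ![(1, 0), (0, 1), (1, 1), (1, 2)] i

/-- The action of a matrix on the indices of the points of `ℙ¹(𝔽₃)`. -/
def pointSMul (a b c d : ZMod 3) (i : Fin 4) : Fin 4 :=
  pointIdx (a * (pointRep i).1 + b * (pointRep i).2, c * (pointRep i).1 + d * (pointRep i).2)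

theorem pointSMul_mul : ∀ (a b c d a' b' c' d' : ZMod 3) (i : Fin 4), a * d - b * c = 1 →
    a' * d' - b' * c' = 1 →
    pointSMul (a * a' + b * c') (a * b' + b * d') (c * a' + d * c') (c * b' + d * d') i =
      pointSMul a b c d (pointSMul a' b' c' d' i) := by
  decide +kernel

theorem pointSMul_one : ∀ i : Fin 4, pointSMul 1 0 0 1 i = i := by decide

theorem eq_scalar_of_pointSMul : ∀ a b c d : ZMod 3, a * d - b * c = 1 →
    (∀ i, pointSMul a b c d i = i) → b = 0 ∧ c = 0 ∧ a = d := by decide +kernel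

theorem pointSMul_scalar : ∀ a b c d : ZMod 3, a * d - b * c = 1 → b = 0 → c = 0 → a = d →
    ∀ i, pointSMul a b c d i = i := by decide +kernel

theorem exists_pointSMul_eq : ∀ σ : Equiv.Perm (Fin 4), sign σ = 1 →
    ∃ a b c d : ZMod 3, a * d - b * c = 1 ∧ ∀ i, pointSMul a b c d i = σ i := by
  decide +kernel

theorem sign_of_pointSMul_eq : ∀ σ : Equiv.Perm (Fin 4), ∀ a b c d : ZMod 3,
    a * d - b * c = 1 → (∀ i, pointSMul a b c d i = σ i) → sign σ = 1 := by
  decide +kernel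

/-- The action of `SL₂(𝔽₃)` on the four points of `ℙ¹(𝔽₃)`. -/
def toPerm : Matrix.SpecialLinearGroup (Fin 2) (ZMod 3) →* Equiv.Perm (Fin 4) :=
  letI : MulAction (Matrix.SpecialLinearGroup (Fin 2) (ZMod 3)) (Fin 4) :=
    { smul := fun A i ↦ pointSMul (A 0 0) (A 0 1) (A 1 0) (A 1 1) i
      one_smul := fun i ↦ pointSMul_one i
      mul_smul := fun A B i ↦ by
        have hA := A.det_coe
        have hB := B.det_coe
        rw [Matrix.det_fin_two] at hA hB
        change pointSMul ((A * B) 0 0) ((A * B) 0 1) ((A * B) 1 0) ((A * B) 1 1) i =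
          pointSMul (A 0 0) (A 0 1) (A 1 0) (A 1 1) (pointSMul (B 0 0) (B 0 1) (B 1 0) (B 1 1) i)
        rw [← pointSMul_mul _ _ _ _ _ _ _ _ i hA hB]
        simp [Matrix.mul_apply, Fin.sum_univ_two] }
  MulAction.toPermHom _ _

theorem toPerm_apply (A : Matrix.SpecialLinearGroup (Fin 2) (ZMod 3)) (i : Fin 4) :
    toPerm A i = pointSMul (A 0 0) (A 0 1) (A 1 0) (A 1 1) i := rfl

theorem ker_toPerm :
    toPerm.ker = Subgroup.center (Matrix.SpecialLinearGroup (Fin 2) (ZMod 3)) := by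
  ext A
  have hA := A.det_coe
  rw [Matrix.det_fin_two] at hA
  rw [MonoidHom.mem_ker, Matrix.SpecialLinearGroup.mem_center_iff]
  constructor
  · intro h
    obtain ⟨hb, hc, had⟩ := eq_scalar_of_pointSMul _ _ _ _ hA fun i ↦ by
      rw [← toPerm_apply, h]; rfl
    refine ⟨A 0 0, ?_, ?_⟩
    · rw [hb, ← had] at hA
      simp only [Fintype.card_fin]
      linear_combination hA
    · ext i j
      fin_cases i <;> fin_cases j <;> simp [hb, hc, had]
  · rintro ⟨r, -, hr⟩
    ext i : 1
    rw [toPerm_apply]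
    have h : ∀ i j, A i j = Matrix.scalar (Fin 2) r i j := fun i j ↦ by rw [hr]
    exact pointSMul_scalar _ _ _ _ hA (by simp [h]) (by simp [h]) (by simp [h]) i

theorem range_toPerm : toPerm.range = alternatingGroup (Fin 4) := by
  ext σ
  rw [mem_alternatingGroup]
  constructor
  · rintro ⟨A, rfl⟩
    have hA := A.det_coe
    rw [Matrix.det_fin_two] at hA
    exact sign_of_pointSMul_eq _ _ _ _ _ hA fun i ↦ (toPerm_apply A i).symm
  · intro h
    obtain ⟨a, b, c, d, hdet, hσ⟩ := exists_pointSMul_eq σ h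
    exact ⟨(⟨!![a, b; c, d], by rwa [Matrix.det_fin_two_of]⟩ :
      Matrix.SpecialLinearGroup (Fin 2) (ZMod 3)),
      Equiv.ext fun i ↦ (toPerm_apply _ i).trans (hσ i)⟩

/-- `PSL₂(𝔽₃)` is isomorphic to the alternating group on four letters. -/
noncomputable def equivAlternating : PSL2 (ZMod 3) ≃* alternatingGroup (Fin 4) :=
  (QuotientGroup.quotientMulEquivOfEq ker_toPerm.symm).trans
    ((QuotientGroup.quotientKerEquivRange toPerm).trans (MulEquiv.subgroupCongr range_toPerm))

end PSLTwoThree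

/-- A group `G` with a normal subgroup `N` and an element `s` generating `G` modulo `N`, such that
the conjugates of an action of `N` on four points by the powers of `s` are jointly faithful on `N`.
The action extends to a subgroup `H` containing `s ^ 9`, and `frob` is an element of `N` of
prescribed cycle types. -/
structure FiberAction (G : Type*) [Group G] where
  (N H : Subgroup G)
  normal : N.Normal
  le : N ≤ H
  s : G
  pow_nine_mem : s ^ 9 ∈ H
  f : G → Equiv.Perm (Fin 4)
  map_mul : ∀ x ∈ H, ∀ y ∈ H, f (x * y) = f x * f y
  sign_of_mem : ∀ n ∈ N, Equiv.Perm.sign (f n) = 1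
  sign_pow_nine : Equiv.Perm.sign (f (s ^ 9)) = -1
  eq_one : ∀ n ∈ N, (∀ i < 9, f ((s ^ i)⁻¹ * n * s ^ i) = 1) → n = 1
  exists_pow_mul_mem : ∀ g : G, ∃ k : ℕ, s ^ k * g ∈ N
  pow_mem_iff : ∀ k : ℕ, s ^ k ∈ N ↔ 18 ∣ k
  frob : G
  frob_mem : frob ∈ N
  frob_sq_ne : f frob ^ 2 ≠ 1
  frob_sq : ∀ i, 1 ≤ i → i < 9 → f ((s ^ i)⁻¹ * frob * s ^ i) ^ 2 = 1
  frob_ne : ∃ i, 1 ≤ i ∧ i < 9 ∧ f ((s ^ i)⁻¹ * frob * s ^ i) ≠ 1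

namespace FiberAction

open Equiv.Perm

theorem pow_four_eq_self : ∀ σ : Equiv.Perm (Fin 4), sign σ = 1 → σ ^ 2 ≠ 1 → σ ^ 4 = σ := by
  decide +kernel

theorem exists_pow_mul_pow_mul_pow : ∀ a v σ : Equiv.Perm (Fin 4), sign a = 1 → a ^ 2 ≠ 1 →
    sign v = 1 → v ^ 2 = 1 → v ≠ 1 → sign σ = 1 →
    ∃ i j k : Fin 3, σ = a ^ i.1 * (v * a * v⁻¹) ^ j.1 * a ^ k.1 := by
  decide +kernel

/-- A subgroup of the symmetric group on four letters containing an even permutation of order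
three, and a conjugate of it by a double transposition, contains all even permutations. -/
theorem mem_of_sign_eq_one (T : Subgroup (Equiv.Perm (Fin 4))) {a v σ : Equiv.Perm (Fin 4)}
    (haT : a ∈ T) (hvT : v * a * v⁻¹ ∈ T) (ha : sign a = 1) (ha2 : a ^ 2 ≠ 1) (hv : sign v = 1)
    (hv2 : v ^ 2 = 1) (hv1 : v ≠ 1) (hσ : sign σ = 1) : σ ∈ T := by
  obtain ⟨i, j, k, rfl⟩ := exists_pow_mul_pow_mul_pow a v σ ha ha2 hv hv2 hv1 hσ
  exact T.mul_mem (T.mul_mem (T.pow_mem haT _) (T.pow_mem hvT _)) (T.pow_mem haT _)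

theorem isSolvable_pi_alternatingGroup (ι : Type*) :
    Group.IsSolvable (ι → alternatingGroup (Fin 4)) := by
  have h4 : Nat.card (Fin 4) = 4 := by simp
  have := alternatingGroup.kleinFour_isKleinFour h4
  let g : (ι → alternatingGroup (Fin 4)) →* (ι → Abelianization (alternatingGroup (Fin 4))) :=
    MonoidHom.pi fun i ↦ Abelianization.of.comp (Pi.evalMonoidHom _ i)
  have hg : Group.IsSolvable g.ker := by
    refine Group.isSolvable_of_comm fun x y ↦ Subtype.ext (funext fun i ↦ ?_)
    have key : ∀ x ∈ g.ker, x i ∈ alternatingGroup.kleinFour (Fin 4) := fun x hx ↦ by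
      rw [alternatingGroup.kleinFour_eq_commutator h4, ← Abelianization.ker_of]
      exact congrFun hx i
    exact congrArg Subtype.val (IsKleinFour.isMulCommutative.is_comm.comm
      (⟨x.1 i, key _ x.2⟩ : alternatingGroup.kleinFour (Fin 4)) ⟨y.1 i, key _ y.2⟩)
  exact Group.isSolvable_of_ker_le_range g.ker.subtype g (by simp)

variable {G : Type*} [Group G] (F : FiberAction G)

/-- The `i`-th coordinate of an element of `G`. -/
def coord (i : ℕ) (n : G) : Equiv.Perm (Fin 4) := F.f ((F.s ^ i)⁻¹ * n * F.s ^ i)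

theorem map_one : F.f 1 = 1 := by
  simpa using F.map_mul 1 F.H.one_mem 1 F.H.one_mem

theorem conj_mem {n : G} (hn : n ∈ F.N) (g : G) : g * n * g⁻¹ ∈ F.N := F.normal.conj_mem n hn g

theorem conj_mem' {n : G} (hn : n ∈ F.N) (g : G) : g⁻¹ * n * g ∈ F.N := by
  simpa using F.conj_mem hn g⁻¹

theorem map_inv {x : G} (hx : x ∈ F.H) : F.f x⁻¹ = (F.f x)⁻¹ := by
  rw [eq_inv_iff_mul_eq_one, ← F.map_mul _ (F.H.inv_mem hx) _ hx, inv_mul_cancel, F.map_one]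

/-- The coordinates of the elements of `N`. -/
def coordHom : F.N →* (Fin 9 → alternatingGroup (Fin 4)) :=
  MonoidHom.pi fun i ↦
    { toFun := fun n ↦ ⟨F.coord i n, mem_alternatingGroup.2 (F.sign_of_mem _ (F.conj_mem' n.2 _))⟩
      map_one' := Subtype.ext (by simp [coord, F.map_one])
      map_mul' := fun x y ↦ Subtype.ext (by
        simp only [coord, Subgroup.coe_mul]
        rw [← F.map_mul _ (F.le (F.conj_mem' x.2 _)) _ (F.le (F.conj_mem' y.2 _))]
        congr 1
        group) }

theorem coordHom_apply (n : F.N) (i : Fin 9) : (F.coordHom n i : Equiv.Perm (Fin 4)) =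
  F.coord i n := rfl

theorem coordHom_injective : Function.Injective F.coordHom := by
  rw [injective_iff_map_eq_one]
  refine fun n hn ↦ Subtype.ext (F.eq_one n n.2 fun i hi ↦ ?_)
  have := congrArg Subtype.val (congrFun hn ⟨i, hi⟩)
  exact this

theorem coord_mul {x y : G} (i : ℕ) (hx : x ∈ F.N) (hy : y ∈ F.N) :
    F.coord i (x * y) = F.coord i x * F.coord i y := by
  rw [coord, coord, coord, ← F.map_mul _ (F.le (F.conj_mem' hx _)) _ (F.le (F.conj_mem' hy _))]
  congr 1
  group

theorem coord_pow {x : G} (i : ℕ) (hx : x ∈ F.N) (k : ℕ) :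
    F.coord i (x ^ k) = F.coord i x ^ k := by
  induction k with
  | zero => simp [coord, F.map_one]
  | succ k ih => rw [pow_succ, F.coord_mul i (F.N.pow_mem hx k) hx, ih, pow_succ]

/-- Elements of `N` all of whose coordinates except possibly the one at `0` are trivial. -/
def IsLocal (n : G) : Prop := n ∈ F.N ∧ ∀ i, 1 ≤ i → i < 9 → F.coord i n = 1

/-- The values of the coordinate at `0` of the elements supported at `0`. -/
def localImage : Subgroup (Equiv.Perm (Fin 4)) where
  carrier := {σ | ∃ n, F.IsLocal n ∧ F.f n = σ}
  one_mem' := ⟨1, ⟨F.N.one_mem, fun i _ _ ↦ by simp [coord, F.map_one]⟩, F.map_one⟩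
  mul_mem' := by
    rintro _ _ ⟨m, hm, rfl⟩ ⟨n, hn, rfl⟩
    refine ⟨m * n, ⟨F.N.mul_mem hm.1 hn.1, fun i h1 h9 ↦ ?_⟩, F.map_mul _ (F.le hm.1) _ (F.le hn.1)⟩
    rw [F.coord_mul i hm.1 hn.1, hm.2 i h1 h9, hn.2 i h1 h9, one_mul]
  inv_mem' := by
    rintro _ ⟨n, hn, rfl⟩
    refine ⟨n⁻¹, ⟨F.N.inv_mem hn.1, fun i h1 h9 ↦ ?_⟩, F.map_inv (F.le hn.1)⟩
    have h := F.coord_mul i hn.1 (F.N.inv_mem hn.1)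
    rw [hn.2 i h1 h9, one_mul, mul_inv_cancel] at h
    rw [← h]
    simp [coord, F.map_one]

theorem IsLocal.conj {n v : G} (hn : F.IsLocal n) (hv : v ∈ F.N) : F.IsLocal (v * n * v⁻¹) := by
  refine ⟨F.conj_mem hn.1 v, fun i h1 h9 ↦ ?_⟩
  rw [F.coord_mul i (F.N.mul_mem hv hn.1) (F.N.inv_mem hv), F.coord_mul i hv hn.1,
    hn.2 i h1 h9, mul_one, ← F.coord_mul i hv (F.N.inv_mem hv), mul_inv_cancel]
  simp [coord, F.map_one]

theorem isLocal_frob : F.IsLocal (F.frob ^ 4) := by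
  refine ⟨F.N.pow_mem F.frob_mem 4, fun i h1 h9 ↦ ?_⟩
  have h : F.coord i F.frob ^ 2 = 1 := F.frob_sq i h1 h9
  rw [F.coord_pow i F.frob_mem, pow_mul _ 2 2, h, one_pow]

theorem coord_zero (n : G) : F.coord 0 n = F.f n := by simp [coord]

theorem mem_localImage {σ : Equiv.Perm (Fin 4)} (hσ : sign σ = 1) : σ ∈ F.localImage := by
  obtain ⟨i, h1, h9, hne⟩ := F.frob_ne
  have hf : F.f (F.frob ^ 4) = F.f F.frob := by
    rw [← coord_zero, F.coord_pow 0 F.frob_mem, coord_zero,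
      pow_four_eq_self _ (F.sign_of_mem _ F.frob_mem) F.frob_sq_ne]
  have hv := F.conj_mem' F.frob_mem (F.s ^ i)
  refine mem_of_sign_eq_one _ (a := F.f F.frob) ⟨_, F.isLocal_frob, hf⟩
    ⟨_, F.isLocal_frob.conj F hv, ?_⟩ (F.sign_of_mem _ F.frob_mem) F.frob_sq_ne
    (F.sign_of_mem _ hv) (F.frob_sq i h1 h9) hne hσ
  rw [F.map_mul _ (F.le (F.N.mul_mem hv (F.N.pow_mem F.frob_mem 4))) _ (F.le (F.N.inv_mem hv)),
    F.map_mul _ (F.le hv) _ (F.le (F.N.pow_mem F.frob_mem 4)), hf, F.map_inv (F.le hv)]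

theorem IsLocal.coord_conj {n : G} (hn : F.IsLocal n) {i j : ℕ} (hi : i < 9) (hj : j < 9) :
    F.coord i (F.s ^ j * n * (F.s ^ j)⁻¹) = if i = j then F.f n else 1 := by
  rcases lt_trichotomy i j with h | rfl | h
  · rw [if_neg h.ne]
    have h1 := hn.2 (9 - (j - i)) (by omega) (by omega)
    have h2 : (F.s ^ i)⁻¹ * (F.s ^ j * n * (F.s ^ j)⁻¹) * F.s ^ i =
        F.s ^ 9 * ((F.s ^ (9 - (j - i)))⁻¹ * n * F.s ^ (9 - (j - i))) * (F.s ^ 9)⁻¹ := by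
      obtain ⟨k, rfl⟩ := Nat.exists_eq_add_of_lt h
      obtain ⟨l, hl⟩ : ∃ l, 9 = l + (k + 1) := ⟨8 - k, by omega⟩
      rw [show 9 - (i + k + 1 - i) = l by omega, hl]
      simp only [pow_add, mul_inv_rev, pow_one]
      group
    have h3 := F.conj_mem' hn.1 (F.s ^ (9 - (j - i)))
    rw [coord, h2, F.map_mul _ (F.H.mul_mem F.pow_nine_mem (F.le h3)) _
      (F.H.inv_mem F.pow_nine_mem), F.map_mul _ F.pow_nine_mem _ (F.le h3),
      show F.f _ = 1 from h1, mul_one, F.map_inv F.pow_nine_mem, mul_inv_cancel]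
  · rw [if_pos rfl, coord]
    congr 1
    group
  · rw [if_neg h.ne']
    obtain ⟨k, rfl⟩ := Nat.exists_eq_add_of_lt h
    rw [← hn.2 (k + 1) (by omega) (by omega), coord, coord]
    congr 1
    simp only [pow_add, mul_inv_rev, pow_one]
    group

theorem coordHom_surjective : Function.Surjective F.coordHom := by
  rw [← MonoidHom.range_eq_top, eq_top_iff]
  intro x _
  have hx : x ∈ Subgroup.pi Set.univ fun i : Fin 9 ↦ (⊤ : Subgroup (alternatingGroup (Fin 4))) :=
    fun _ _ ↦ trivial
  refine Subgroup.pi_mem_of_mulSingle_mem x fun j ↦ ?_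
  obtain ⟨n, hn, hnj⟩ := F.mem_localImage (mem_alternatingGroup.1 (x j).2)
  refine ⟨⟨_, F.conj_mem hn.1 (F.s ^ (j : ℕ))⟩, ?_⟩
  ext1 i
  apply Subtype.ext
  rw [coordHom_apply, hn.coord_conj F i.2 j.2, hnj]
  rcases eq_or_ne i j with rfl | h
  · simp
  · rw [if_neg (by simpa [Fin.ext_iff] using h), Pi.mulSingle_eq_of_ne h]
    rfl

/-- The normal subgroup of a fiber action is a power of the alternating group. -/
noncomputable def equivPi : F.N ≃* (Fin 9 → alternatingGroup (Fin 4)) :=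
  MulEquiv.ofBijective F.coordHom ⟨F.coordHom_injective, F.coordHom_surjective⟩

theorem isSolvable {G : Type*} [Group G] (F : FiberAction G) : Group.IsSolvable G := by
  have := F.normal
  have hN : Group.IsSolvable F.N :=
    have := isSolvable_pi_alternatingGroup (Fin 9)
    Group.isSolvable_of_isSolvable_injective (f := F.equivPi.toMonoidHom) F.equivPi.injective
  have hQ : Group.IsSolvable (G ⧸ F.N) := by
    have key : ∀ x : G ⧸ F.N, x ∈ Subgroup.zpowers (F.s : G ⧸ F.N) := by
      intro x
      induction x using QuotientGroup.induction_on with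
      | H g =>
        obtain ⟨k, hk⟩ := F.exists_pow_mul_mem g
        rw [← QuotientGroup.eq_one_iff, QuotientGroup.mk_mul, QuotientGroup.mk_pow] at hk
        rw [eq_inv_of_mul_eq_one_right hk]
        exact inv_mem (Subgroup.npow_mem_zpowers _ _)
    refine Group.isSolvable_of_comm fun x y ↦ ?_
    obtain ⟨i, rfl⟩ := key x
    obtain ⟨j, rfl⟩ := key y
    exact ((Commute.refl _).zpow_zpow i j)
  exact (Group.isSolvable_iff_subgroup_quotient F.N).2 ⟨hN, hQ⟩

theorem exists_mul_pow {n : G} (hn : n ∈ F.N) (k : ℕ) :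
    ∃ m ∈ F.N, (n * F.s) ^ k = m * F.s ^ k := by
  induction k with
  | zero => exact ⟨1, F.N.one_mem, by simp⟩
  | succ k ih =>
    obtain ⟨m, hm, h⟩ := ih
    refine ⟨m * (F.s ^ k * n * (F.s ^ k)⁻¹), F.N.mul_mem hm (F.conj_mem hn _), ?_⟩
    rw [pow_succ, h, pow_succ]
    group

theorem IsLocal.exists_mul_pow {n : G} (hn : F.IsLocal n) {k : ℕ} (hk : k < 9) :
    ∃ m ∈ F.N, F.f m = F.f n ∧ (n * F.s) ^ (k + 1) = m * F.s ^ (k + 1) := by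
  induction k with
  | zero => exact ⟨n, hn.1, rfl, by simp⟩
  | succ k ih =>
    obtain ⟨m, hm, hmn, h⟩ := ih (by omega)
    have hc := F.conj_mem hn.1 (F.s ^ (k + 1))
    refine ⟨m * (F.s ^ (k + 1) * n * (F.s ^ (k + 1))⁻¹), F.N.mul_mem hm hc, ?_, ?_⟩
    · rw [F.map_mul _ (F.le hm) _ (F.le hc), ← F.coord_zero (F.s ^ (k + 1) * n * _),
        hn.coord_conj F (by norm_num) hk, if_neg (by omega), mul_one, hmn]
    · rw [pow_succ, h, pow_succ _ (k + 1)]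
      group

/-- There is a lift of the generator of `G ⧸ N` to an element of order `18`. -/
theorem exists_lift : ∃ n ∈ F.N, (n * F.s) ^ 18 = 1 := by
  obtain ⟨n, hn, hnf⟩ := F.mem_localImage (σ := Equiv.swap 0 1 * (F.f (F.s ^ 9))⁻¹)
    (by rw [Equiv.Perm.sign_mul, Equiv.Perm.sign_inv, F.sign_pow_nine, sign_swap (by decide)]; rfl)
  refine ⟨n, hn.1, ?_⟩
  obtain ⟨m, hm, hmn, h⟩ := hn.exists_mul_pow F (k := 8) (by norm_num)
  have hf : F.f ((n * F.s) ^ 9) = Equiv.swap 0 1 := by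
    rw [h, F.map_mul _ (F.le hm) _ F.pow_nine_mem, hmn, hnf, inv_mul_cancel_right]
  have hH : (n * F.s) ^ 9 ∈ F.H := h ▸ F.H.mul_mem (F.le hm) F.pow_nine_mem
  have hf' : F.f ((n * F.s) ^ 18) = 1 := by
    rw [pow_add _ 9 9, F.map_mul _ hH _ hH, hf, Equiv.swap_mul_self]
  have hN : (n * F.s) ^ 18 ∈ F.N := by
    obtain ⟨m, hm, h⟩ := F.exists_mul_pow hn.1 18
    exact h ▸ F.N.mul_mem hm ((F.pow_mem_iff 18).2 dvd_rfl)
  refine F.eq_one _ hN fun i _ ↦ ?_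
  obtain ⟨m, hm, h⟩ := F.exists_mul_pow hn.1 i
  have hu := F.conj_mem' hm (F.s ^ i)
  have : (F.s ^ i)⁻¹ * (n * F.s) ^ 18 * F.s ^ i =
      ((F.s ^ i)⁻¹ * m * F.s ^ i) * (n * F.s) ^ 18 * ((F.s ^ i)⁻¹ * m * F.s ^ i)⁻¹ := by
    have hs : F.s ^ i = m⁻¹ * (n * F.s) ^ i := by rw [h]; group
    rw [hs]
    generalize n * F.s = t
    group
  rw [this, F.map_mul _ (F.le (F.N.mul_mem hu hN)) _ (F.le (F.N.inv_mem hu)),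
    F.map_mul _ (F.le hu) _ (F.le hN), hf', mul_one, F.map_inv (F.le hu), mul_inv_cancel]

theorem exists_mulEquiv_semidirectProduct {G A : Type*} [Group G] [Group A]
    (F : FiberAction G) (e : A ≃* alternatingGroup (Fin 4)) :
    ∃ φ : Multiplicative (ZMod 18) →* MulAut (Fin 9 → A),
      Nonempty (G ≃* SemidirectProduct (Fin 9 → A) (Multiplicative (ZMod 18)) φ) := by
  have := F.normal
  obtain ⟨n, hn, h18⟩ := F.exists_lift
  have hmem : ∀ k, (n * F.s) ^ k ∈ F.N ↔ 18 ∣ k := fun k ↦ by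
    obtain ⟨m, hm, h⟩ := F.exists_mul_pow hn k
    rw [h, Subgroup.mul_mem_cancel_left _ hm, F.pow_mem_iff]
  have hgen : ∀ g, ∃ k : ℕ, (n * F.s) ^ k * g ∈ F.N := fun g ↦ by
    obtain ⟨k, hk⟩ := F.exists_pow_mul_mem g
    obtain ⟨m, hm, h⟩ := F.exists_mul_pow hn k
    exact ⟨k, by rw [h, mul_assoc]; exact F.N.mul_mem hm hk⟩
  generalize n * F.s = t at *
  have hord : orderOf t = 18 :=
    Nat.dvd_antisymm (orderOf_dvd_of_pow_eq_one h18)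
      ((hmem _).1 (by rw [pow_orderOf_eq_one]; exact F.N.one_mem))
  have hcompl : F.N.IsComplement' (Subgroup.zpowers t) := by
    refine Subgroup.isComplement'_of_disjoint_and_mul_eq_univ ?_ ?_
    · rw [Subgroup.disjoint_def]
      intro x hx hxt
      have hfin : IsOfFinOrder t := isOfFinOrder_iff_pow_eq_one.2 ⟨18, by norm_num, h18⟩
      obtain ⟨k, rfl⟩ := Submonoid.mem_powers_iff _ _ |>.1 (hfin.mem_powers_iff_mem_zpowers.2 hxt)
      exact orderOf_dvd_iff_pow_eq_one.1 (hord ▸ (hmem k).1 hx)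
    · refine Set.eq_univ_of_forall fun g ↦ ?_
      obtain ⟨k, hk⟩ := hgen g
      exact ⟨(t ^ k)⁻¹ * (t ^ k * g) * t ^ k, F.conj_mem' hk _, (t ^ k)⁻¹,
        inv_mem (Subgroup.npow_mem_zpowers _ _), by group⟩
  have hcard : Nat.card (Subgroup.zpowers t) = Nat.card (Multiplicative (ZMod 18)) := by
    rw [Nat.card_zpowers, hord]; simp
  let e₂ : Subgroup.zpowers t ≃* Multiplicative (ZMod 18) := mulEquivOfCyclicCardEq hcard
  let e₁ : F.N ≃* (Fin 9 → A) := F.equivPi.trans (MulEquiv.piCongrRight fun _ ↦ e.symm)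
  exact ⟨_, ⟨(SemidirectProduct.mulEquivSubgroup hcompl).symm.trans
    (SemidirectProduct.congr' e₁ e₂)⟩⟩

end FiberAction

namespace CyclicQuartic

section Coefficients

variable {R : Type*} [CommRing R]

/-- The cubic coefficient of the quartic attached to `c`. -/
def coeffThree (c : R) : R :=
  -1 + 2 * c + c ^ 2 + c ^ 3 + 2 * c ^ 5 - c ^ 7

/-- The quadratic coefficient of the quartic attached to `c`. -/
def coeffTwo (c : R) : R :=
  -69 + 78 * c + 261 * c ^ 2 - 339 * c ^ 3 - 189 * c ^ 4 + 276 * c ^ 5 + 57 * c ^ 6 -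
  57 * c ^ 7 - 6 * c ^ 8

/-- The linear coefficient of the quartic attached to `c`. -/
def coeffOne (c : R) : R :=
  714 + 1105 * c - 2300 * c ^ 2 - 3029 * c ^ 3 + 2435 * c ^ 4 + 2215 * c ^ 5 - 897 * c ^ 6 -
  437 * c ^ 7 + 114 * c ^ 8

/-- The constant coefficient of the quartic attached to `c`. -/
def coeffZero (c : R) : R :=
  -487 + 1452 * c + 1434 * c ^ 2 - 5543 * c ^ 3 + 818 * c ^ 4 + 4212 * c ^ 5 - 1298 * c ^ 6 -
  866 * c ^ 7 +
  301 * c ^ 8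

/-- The quartic attached to `c`, evaluated at `x`. -/
def quartic (c x : R) : R :=
  x ^ 4 + coeffThree c * x ^ 3 + coeffTwo c * x ^ 2 + coeffOne c * x + coeffZero c

/-- The minimal polynomial of `2 cos (2π / 27)`, evaluated at `c`. -/
def minCos (c : R) : R := c ^ 9 - 9 * c ^ 7 + 27 * c ^ 5 - 30 * c ^ 3 + 9 * c + 1

/-- A square root of `-1 / 27` times the discriminant of the quartic attached to `c`. -/
def rootDisc (c : R) : R :=
  -124407 + 235669 * c + 700330 * c ^ 2 - 786324 * c ^ 3 - 944902 * c ^ 4 + 566753 * c ^ 5 +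
  475257 * c ^ 6 -
  108230 * c ^ 7 - 76313 * c ^ 8

/-- A divisor of `3 ^ 7` complementary to `rootDisc`. -/
def coRootDisc (c : R) : R :=
  -10503316818 - 79459232175 * c + 105271940466 * c ^ 2 + 89597884239 * c ^ 3 -
  111979109340 * c ^ 4 -
  32556873186 * c ^ 5 + 39730239018 * c ^ 6 + 3778283799 * c ^ 7 - 4552735491 * c ^ 8

theorem invariant_two (c : R) (hc : minCos c = 0) :
    12 * coeffZero c - 3 * coeffThree c * coeffOne c + coeffTwo c ^ 2 = 0 := by
  unfold coeffZero coeffOne coeffTwo coeffThree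
  unfold minCos at hc
  linear_combination (
  1059 - 3840 * c + 6162 * c ^ 2 - 3450 * c ^ 3 - 3951 * c ^ 4 + 1578 * c ^ 5 + 1026 * c ^ 6 +
  36 * c ^ 7) * hc

theorem invariant_three (c : R) (hc : minCos c = 0) :
    72 * coeffTwo c * coeffZero c + 9 * coeffThree c * coeffTwo c * coeffOne c
      - 27 * coeffOne c ^ 2 - 27 * coeffZero c * coeffThree c ^ 2 - 2 * coeffTwo c ^ 3 =
      27 * rootDisc c := by
  unfold coeffZero coeffOne coeffTwo coeffThree rootDisc
  unfold minCos at hc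
  linear_combination (
  -6872526 - 84996 * c + 19958697 * c ^ 2 - 3488535 * c ^ 3 - 18513765 * c ^ 4 + 7219071 * c ^ 5 +
  5751783 * c ^ 6 - 8264781 * c ^ 7 - 516294 * c ^ 8 + 4561191 * c ^ 9 - 22869 * c ^ 10 -
  1281825 * c ^ 11 -
  76977 * c ^ 12 + 135297 * c ^ 13 + 18468 * c ^ 14 + 432 * c ^ 15) * hc

theorem rootDisc_mul (c : R) (hc : minCos c = 0) : rootDisc c * coRootDisc c = 2187 := by
  unfold rootDisc coRootDisc
  unfold minCos at hc
  linear_combination (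
  1306686135374739 - 4350196692358668 * c - 26661720925665 * c ^ 2 + 5714594527212918 * c ^ 3 -
  760418264003715 * c ^ 4 - 2477680665270444 * c ^ 5 + 204410390637843 * c ^ 6 +
  347432903524683 * c ^ 7) * hc

theorem minCos_add (w v : R) (hwv : w * v = 1) (h : w ^ 18 + w ^ 9 + 1 = 0) :
    minCos (w + v) = 0 := by
  have h9 : w ^ 9 * v ^ 9 = 1 := by rw [← mul_pow, hwv, one_pow]
  have key : minCos (w + v) = w ^ 9 + v ^ 9 + 1 := by
    have : w ^ 9 + v ^ 9 = (w + v) ^ 9 - 9 * (w * v) * (w + v) ^ 7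
        + 27 * (w * v) ^ 2 * (w + v) ^ 5 - 30 * (w * v) ^ 3 * (w + v) ^ 3
        + 9 * (w * v) ^ 4 * (w + v) := by ring
    rw [this, hwv, minCos]
    ring
  rw [key]
  linear_combination v ^ 9 * h + (-w ^ 9 - 1) * h9

/-- The family `r` lists the roots of the quartic attached to `c`. -/
def IsRootFamily (c : R) (r : Fin 4 → R) : Prop :=
  coeffThree c = -(r 0 + r 1 + r 2 + r 3) ∧
  coeffTwo c = r 0 * r 1 + r 0 * r 2 + r 0 * r 3 + r 1 * r 2 + r 1 * r 3 + r 2 * r 3 ∧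
  coeffOne c = -(r 0 * r 1 * r 2 + r 0 * r 1 * r 3 + r 0 * r 2 * r 3 + r 1 * r 2 * r 3) ∧
  coeffZero c = r 0 * r 1 * r 2 * r 3

theorem IsRootFamily.quartic_eq {c : R} {r : Fin 4 → R} (h : IsRootFamily c r) (x : R) :
    quartic c x = (x - r 0) * (x - r 1) * (x - r 2) * (x - r 3) := by
  rw [quartic, h.1, h.2.1, h.2.2.1, h.2.2.2]
  ring

/-- The square root of the discriminant. -/
def sqrtDisc (r : Fin 4 → R) : R := (Matrix.vandermonde r).det

theorem sqrtDisc_eq (r : Fin 4 → R) : sqrtDisc r =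
    (r 1 - r 0) * (r 2 - r 0) * (r 3 - r 0) * ((r 2 - r 1) * (r 3 - r 1)) * (r 3 - r 2) := by
  have h0 : Finset.Ioi (0 : Fin 4) = {1, 2, 3} := by decide
  have h1 : Finset.Ioi (1 : Fin 4) = {2, 3} := by decide
  have h2 : Finset.Ioi (2 : Fin 4) = {3} := by decide
  have h3 : Finset.Ioi (3 : Fin 4) = ∅ := by decide
  rw [sqrtDisc, Matrix.det_vandermonde, Fin.prod_univ_four, h0, h1, h2, h3]
  simp
  ring

theorem sqrtDisc_comp (r : Fin 4 → R) (σ : Equiv.Perm (Fin 4)) :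
    sqrtDisc (fun a ↦ r (σ a)) = (Equiv.Perm.sign σ : ℤ) * sqrtDisc r := by
  rw [sqrtDisc, sqrtDisc, ← Matrix.det_permute]
  rfl

theorem IsRootFamily.mul_sqrtDisc_sq {c : R} {r : Fin 4 → R} (h : IsRootFamily c r)
    (hc : minCos c = 0) : 27 * sqrtDisc r ^ 2 = 27 * (-27 * rootDisc c ^ 2) := by
  have hI := invariant_two c hc
  have hJ := invariant_three c hc
  rw [h.1, h.2.1, h.2.2.1, h.2.2.2] at hI hJ
  rw [sqrtDisc_eq]
  generalize r 0 = x, r 1 = y, r 2 = z, r 3 = t at *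
  generalize hi : 12 * (x * y * z * t) - 3 * -(x + y + z + t) *
    -(x * y * z + x * y * t + x * z * t + y * z * t) +
    (x * y + x * z + x * t + y * z + y * t + z * t) ^ 2 = i at hI
  generalize hj : 72 * (x * y + x * z + x * t + y * z + y * t + z * t) * (x * y * z * t)
    + 9 * -(x + y + z + t) * (x * y + x * z + x * t + y * z + y * t + z * t) *
    -(x * y * z + x * y * t + x * z * t + y * z * t)
    - 27 * (-(x * y * z + x * y * t + x * z * t + y * z * t)) ^ 2
    - 27 * (x * y * z * t) * (-(x + y + z + t)) ^ 2
    - 2 * (x * y + x * z + x * t + y * z + y * t + z * t) ^ 3 = j at hJ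
  have key : 27 * ((y - x) * (z - x) * (t - x) * ((z - y) * (t - y)) * (t - z)) ^ 2 =
      4 * i ^ 3 - j ^ 2 := by
    rw [← hi, ← hj]
    ring
  rw [key, hI, hJ]
  ring

end Coefficients

section Map

variable {R S : Type*} [CommRing R] [CommRing S] (f : R →+* S)

theorem map_quartic (c x : R) : f (quartic c x) = quartic (f c) (f x) := by
  simp [quartic, coeffThree, coeffTwo, coeffOne, coeffZero, map_ofNat]

theorem map_rootDisc (c : R) : f (rootDisc c) = rootDisc (f c) := by
  simp [rootDisc, map_ofNat]

theorem map_sqrtDisc (r : Fin 4 → R) : f (sqrtDisc r) = sqrtDisc (f ∘ r) := by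
  simp [sqrtDisc_eq]

theorem IsRootFamily.quartic_apply {c : R} {r : Fin 4 → R} (h : IsRootFamily c r) (a : Fin 4) :
    quartic c (r a) = 0 := by
  rw [h.quartic_eq]
  fin_cases a <;> simp

theorem IsRootFamily.exists_eq [IsDomain R] {c : R} {r : Fin 4 → R} (h : IsRootFamily c r) {x : R}
    (hx : quartic c x = 0) : ∃ a, x = r a := by
  rw [h.quartic_eq] at hx
  simp only [mul_eq_zero, sub_eq_zero] at hx
  tauto

end Map

section Domain

variable {R : Type*} [CommRing R] [IsDomain R] {ζ : R}

theorem pow_eighteen_add (hζ : IsPrimitiveRoot ζ 27) : ζ ^ 18 + ζ ^ 9 + 1 = 0 := by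
  have h9 : ζ ^ 9 - 1 ≠ 0 := sub_ne_zero.2 (hζ.pow_ne_one_of_pos_of_lt (by norm_num) (by norm_num))
  refine (mul_eq_zero.1 (?_ : (ζ ^ 9 - 1) * _ = 0)).resolve_left h9
  linear_combination hζ.pow_eq_one

/-- The trace of a `27`-th root of unity. -/
def trace (w : R) : R := w + w ^ 26

theorem minCos_trace (hζ : IsPrimitiveRoot ζ 27) : minCos (trace ζ) = 0 :=
  minCos_add _ _ (by rw [← hζ.pow_eq_one]; ring) (pow_eighteen_add hζ)

/-- Distinct roots of unity of order dividing `27` are distinct modulo every prime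
not dividing `3`. -/
theorem pow_eq_of_sub_mem {x y : R} (hx : x ^ 27 = 1) (hy : y ^ 27 = 1)
    (Q : Ideal R) [Q.IsPrime] (hQ : (3 : R) ∉ Q) (hxy : x - y ∈ Q) : x = y := by
  by_contra hne
  have h : ∑ i ∈ Finset.range 27, x ^ i * y ^ (27 - 1 - i) = 0 := by
    refine (mul_eq_zero.1 ((Commute.all x y).geom_sum₂_mul 27 ▸ ?_ :
      (∑ i ∈ Finset.range 27, x ^ i * y ^ (27 - 1 - i)) * (x - y) = 0)).resolve_right
      (sub_ne_zero.2 hne)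
    rw [hx, hy, sub_self]
  have hmk : Ideal.Quotient.mk Q x = Ideal.Quotient.mk Q y := Ideal.Quotient.eq.2 hxy
  have h' := congrArg (Ideal.Quotient.mk Q) h
  rw [map_sum] at h'
  have key : ∀ i ∈ Finset.range 27, Ideal.Quotient.mk Q (x ^ i * y ^ (27 - 1 - i)) =
      Ideal.Quotient.mk Q (y ^ 26) := fun i hi ↦ by
    rw [map_mul, map_pow, hmk, map_pow, ← pow_add, map_pow]
    congr 1
    have := Finset.mem_range.1 hi
    omega
  rw [Finset.sum_congr rfl key, Finset.sum_const, Finset.card_range, ← map_nsmul, map_zero,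
    Ideal.Quotient.eq_zero_iff_mem, nsmul_eq_mul] at h'
  have h27 : ((3 : R) ^ 3) ∈ Q := by
    have := Q.mul_mem_left y h'
    rwa [show y * ((27 : ℕ) * y ^ 26) = 3 ^ 3 * y ^ 27 by push_cast; ring, hy, mul_one] at this
  exact hQ (Ideal.IsPrime.mem_of_pow_mem inferInstance 3 h27)

variable [CharZero R]

theorem IsRootFamily.sqrtDisc_sq {c : R} {r : Fin 4 → R} (h : IsRootFamily c r)
    (hc : minCos c = 0) : sqrtDisc r ^ 2 = -27 * rootDisc c ^ 2 :=
  mul_left_cancel₀ (by norm_num) (h.mul_sqrtDisc_sq hc)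

theorem IsRootFamily.sqrtDisc_eq_or {r : Fin 4 → R} (hζ : IsPrimitiveRoot ζ 27)
    (h : IsRootFamily (trace ζ) r) :
    sqrtDisc r = 3 * (1 + 2 * ζ ^ 9) * rootDisc (trace ζ) ∨
      sqrtDisc r = -(3 * (1 + 2 * ζ ^ 9) * rootDisc (trace ζ)) := by
  rw [← sq_eq_sq_iff_eq_or_eq_neg, h.sqrtDisc_sq (minCos_trace hζ)]
  linear_combination -36 * rootDisc (trace ζ) ^ 2 * pow_eighteen_add hζ

/-- The roots of the quartic are distinct modulo every prime not dividing `3`. -/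
theorem IsRootFamily.eq_of_sub_mem {c : R} {r : Fin 4 → R} (h : IsRootFamily c r)
    (hc : minCos c = 0) (Q : Ideal R) [Q.IsPrime] (hQ : (3 : R) ∉ Q) {a b : Fin 4}
    (hab : r a - r b ∈ Q) : a = b := by
  by_contra hne
  have hD : sqrtDisc r ∈ Q := by
    rw [← Ideal.Quotient.eq_zero_iff_mem, map_sqrtDisc]
    exact Matrix.det_vandermonde_eq_zero_iff.2 ⟨a, b, Ideal.Quotient.eq.2 hab, hne⟩
  have h3 := Q.mul_mem_left (-(coRootDisc c ^ 2 * sqrtDisc r)) hD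
  have key : -(coRootDisc c ^ 2 * sqrtDisc r) * sqrtDisc r = 3 ^ 17 := by
    linear_combination -coRootDisc c ^ 2 * h.sqrtDisc_sq hc +
      27 * (rootDisc c * coRootDisc c + 2187) * rootDisc_mul c hc
  exact hQ (Ideal.IsPrime.mem_of_pow_mem inferInstance 17 (key ▸ h3))

theorem IsRootFamily.injective {c : R} {r : Fin 4 → R} (h : IsRootFamily c r)
    (hc : minCos c = 0) : Function.Injective r := fun a b hab ↦
  h.eq_of_sub_mem hc ⊥ (by simp) (by simp [hab])

theorem IsRootFamily.sqrtDisc_ne_zero {c : R} {r : Fin 4 → R} (h : IsRootFamily c r)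
    (hc : minCos c = 0) : sqrtDisc r ≠ 0 :=
  Matrix.det_vandermonde_ne_zero_iff.2 (h.injective hc)

end Domain

section SMul

variable {R G : Type*} [CommRing R] [Group G] [MulSemiringAction G R]

theorem smul_trace (g : G) (w : R) : g • trace w = trace (g • w) := by
  simp [trace, smul_add, smul_pow']

theorem smul_quartic (g : G) (c x : R) : g • quartic c x = quartic (g • c) (g • x) :=
  map_quartic (MulSemiringAction.toRingHom G R g) c x

theorem quartic_smul_eq_zero {g : G} {c x : R} (h : quartic c x = 0) :
    quartic (g • c) (g • x) = 0 := by
  rw [← smul_quartic, h, smul_zero]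

end SMul

section Action

variable {R G : Type*} [CommRing R] [IsDomain R] [CharZero R] [Group G] [MulSemiringAction G R]

/-- A ring with a group action containing the `27`-th roots of unity and the roots of the quartics
attached to their traces, on which these elements determine the action. -/
structure Model (G R : Type*) [CommRing R] [IsDomain R] [CharZero R] [Group G]
    [MulSemiringAction G R] where
  ζ : R
  prim : IsPrimitiveRoot ζ 27
  s : G
  smul_root : s • ζ = ζ ^ 2
  r : Fin 4 → R
  family : IsRootFamily (trace ζ) r
  eq_one : ∀ g : G, (∀ w : R, IsPrimitiveRoot w 27 → g • w = w) →
    (∀ w x : R, IsPrimitiveRoot w 27 → quartic (trace w) x = 0 → g • x = x) → g = 1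

namespace Model

variable (M : Model G R)

/-- The trace of the distinguished root of unity. -/
def c : R := trace M.ζ

theorem r_injective : Function.Injective M.r := M.family.injective (minCos_trace M.prim)

theorem exists_eq_r {x : R} (hx : quartic M.c x = 0) : ∃ a, x = M.r a := M.family.exists_eq hx

theorem quartic_r (a : Fin 4) : quartic M.c (M.r a) = 0 := M.family.quartic_apply a

theorem exists_perm {g : G} (hg : g • M.c = M.c) :
    ∃ σ : Equiv.Perm (Fin 4), ∀ a, g • M.r a = M.r (σ a) := by
  have h : ∀ a, ∃ b, g • M.r a = M.r b := fun a ↦ M.exists_eq_r (by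
    have := quartic_smul_eq_zero (g := g) (M.quartic_r a)
    rwa [hg] at this)
  choose f hf using h
  have hinj : Function.Injective f := fun a b hab ↦
    M.r_injective (MulAction.injective g (by simp only [hf, hab]))
  exact ⟨Equiv.ofBijective f (Finite.injective_iff_bijective.1 hinj), hf⟩

open Classical in
/-- The permutation of the roots of the quartic induced by a group element. -/
noncomputable def perm (g : G) : Equiv.Perm (Fin 4) :=
  if h : ∃ σ : Equiv.Perm (Fin 4), ∀ a, g • M.r a = M.r (σ a) then h.choose else 1

theorem smul_r {g : G} (hg : g • M.c = M.c) (a : Fin 4) : g • M.r a = M.r (M.perm g a) := by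
  rw [perm, dif_pos (M.exists_perm hg)]
  exact (M.exists_perm hg).choose_spec a

theorem perm_mul {g h : G} (hg : g • M.c = M.c) (hh : h • M.c = M.c) :
    M.perm (g * h) = M.perm g * M.perm h := by
  ext1 a
  apply M.r_injective
  rw [← M.smul_r (by rw [mul_smul, hh, hg]), mul_smul, M.smul_r hh, M.smul_r hg]
  rfl

theorem smul_eq_pow {g : G} {m : ℕ} (hg : g • M.ζ = M.ζ ^ m) (k : ℕ) :
    g • M.ζ ^ k = M.ζ ^ (m * k) := by
  rw [smul_pow', hg, pow_mul]

theorem exists_smul_eq_pow (g : G) : ∃ m < 27, m.Coprime 27 ∧ g • M.ζ = M.ζ ^ m := by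
  have h : IsPrimitiveRoot (g • M.ζ) 27 :=
    M.prim.map_of_injective (f := MulSemiringAction.toRingHom G R g) (MulAction.injective g)
  obtain ⟨m, hm, h'⟩ := M.prim.eq_pow_of_pow_eq_one h.pow_eq_one
  refine ⟨m, hm, ?_, h'.symm⟩
  rw [← h'] at h
  exact (M.prim.pow_iff_coprime (by norm_num) m).1 h

theorem pow_smul_root (k : ℕ) : M.s ^ k • M.ζ = M.ζ ^ 2 ^ k := by
  induction k with
  | zero => simp
  | succ k ih => rw [pow_succ', mul_smul, ih, smul_pow', M.smul_root, ← pow_mul, pow_succ']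

theorem pow_root_mod (m : ℕ) : M.ζ ^ m = M.ζ ^ (m % 27) := pow_eq_pow_mod m M.prim.pow_eq_one

theorem pow_eq_pow_iff (m n : ℕ) : M.ζ ^ m = M.ζ ^ n ↔ m % 27 = n % 27 := by
  rw [M.pow_root_mod m, M.pow_root_mod n]
  exact ⟨fun h ↦ M.prim.pow_inj (Nat.mod_lt _ (by norm_num)) (Nat.mod_lt _ (by norm_num)) h,
    fun h ↦ by rw [h]⟩

theorem smul_c {g : G} (hg : g • M.ζ = M.ζ) : g • M.c = M.c := by
  rw [c, smul_trace, hg]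

theorem pow_nine_smul_root : M.s ^ 9 • M.ζ = M.ζ ^ 26 := by
  rw [M.pow_smul_root, M.pow_eq_pow_iff]
  rfl

theorem pow_nine_smul_c : M.s ^ 9 • M.c = M.c := by
  rw [c, smul_trace, M.pow_nine_smul_root, trace, trace, ← pow_mul, add_comm]
  congr 1
  simpa using (M.pow_eq_pow_iff (26 * 26) 1).2 rfl

theorem pow_smul_c (k : ℕ) : M.s ^ k • M.c = M.s ^ (k % 9) • M.c := by
  conv_lhs => rw [← Nat.mod_add_div k 9, pow_add, pow_mul, mul_smul]
  congr 1
  generalize k / 9 = j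
  induction j with
  | zero => simp
  | succ j ih => rw [pow_succ, mul_smul, M.pow_nine_smul_c, ih]

theorem smul_sqrtDisc {g : G} (hg : g • M.c = M.c) :
    g • sqrtDisc M.r = (Equiv.Perm.sign (M.perm g) : ℤ) * sqrtDisc M.r := by
  rw [← sqrtDisc_comp]
  refine (map_sqrtDisc (MulSemiringAction.toRingHom G R g) M.r).trans (congrArg sqrtDisc ?_)
  exact funext fun a ↦ M.smul_r hg a

theorem smul_rootDisc {g : G} (hg : g • M.c = M.c) :
    g • (3 * (1 + 2 * M.ζ ^ 9) * rootDisc M.c) =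
      3 * (1 + 2 * (g • M.ζ) ^ 9) * rootDisc M.c := by
  have := map_rootDisc (MulSemiringAction.toRingHom G R g) M.c
  simp only [MulSemiringAction.toRingHom_apply, hg] at this
  rw [smul_mul', this]
  congr 1
  have key (f : R →+* R) (x : R) : f (3 * (1 + 2 * x ^ 9)) = 3 * (1 + 2 * f x ^ 9) := by
    simp [map_ofNat]
  exact key (MulSemiringAction.toRingHom G R g) M.ζ

theorem sign_perm {g : G} (hg : g • M.c = M.c) {e : ℤˣ}
    (he : 1 + 2 * (g • M.ζ) ^ 9 = (e : ℤ) * (1 + 2 * M.ζ ^ 9)) :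
    Equiv.Perm.sign (M.perm g) = e := by
  have h0 : sqrtDisc M.r ≠ 0 := M.family.sqrtDisc_ne_zero (minCos_trace M.prim)
  have h1 := M.smul_sqrtDisc hg
  have h2 := M.smul_rootDisc hg
  rw [he] at h2
  have h3 : g • sqrtDisc M.r = (e : ℤ) * sqrtDisc M.r := by
    rcases M.family.sqrtDisc_eq_or M.prim with h | h
    · rw [h]
      refine h2.trans ?_
      rw [c]; ring
    · rw [h, smul_neg]
      refine (congrArg Neg.neg h2).trans ?_
      rw [c]; ring
  rw [h3] at h1
  exact Units.ext (Int.cast_injective (mul_right_cancel₀ h0 h1)).symm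

theorem exists_two_pow : ∀ m < 27, m.Coprime 27 → ∃ k < 18, 2 ^ k * m % 27 = 1 := by decide

theorem exists_two_pow_eq : ∀ m < 27, m.Coprime 27 → ∃ k < 18, 2 ^ k % 27 = m := by decide

theorem two_pow_mod (k : ℕ) : 2 ^ k % 27 = 1 ↔ 18 ∣ k := by
  have h : ∀ r < 18, 2 ^ r % 27 = 1 ↔ r = 0 := by decide
  rw [← h (k % 18) (Nat.mod_lt _ (by norm_num)) |>.trans (Nat.dvd_iff_mod_eq_zero).symm]
  have h1 : (2 ^ 18) ^ (k / 18) % 27 = 1 := by rw [Nat.pow_mod]; norm_num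
  conv_lhs => rw [← Nat.mod_add_div k 18, pow_add, pow_mul, Nat.mul_mod, h1, mul_one, Nat.mod_mod]

/-- The fiber action attached to a model and a suitable element of the group. -/
noncomputable def fiberAction (φ : G) (hφ : φ • M.ζ = M.ζ) (h_ne : M.perm φ ^ 2 ≠ 1)
    (h_sq : ∀ i, 1 ≤ i → i < 9 → M.perm ((M.s ^ i)⁻¹ * φ * M.s ^ i) ^ 2 = 1)
    (hne : ∃ i, 1 ≤ i ∧ i < 9 ∧ M.perm ((M.s ^ i)⁻¹ * φ * M.s ^ i) ≠ 1) : FiberAction G where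
  N := MulAction.stabilizer G M.ζ
  H := MulAction.stabilizer G M.c
  normal := ⟨fun n hn g ↦ by
    rw [MulAction.mem_stabilizer_iff] at hn ⊢
    obtain ⟨m, -, -, h⟩ := M.exists_smul_eq_pow g⁻¹
    rw [mul_smul, mul_smul, h, smul_pow', hn, ← h, smul_inv_smul]⟩
  le := fun g hg ↦ M.smul_c hg
  s := M.s
  pow_nine_mem := M.pow_nine_smul_c
  f := M.perm
  map_mul := fun x hx y hy ↦ M.perm_mul hx hy
  sign_of_mem := fun n hn ↦ M.sign_perm (M.smul_c hn) (by
    rw [MulAction.mem_stabilizer_iff.1 hn]; simp)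
  sign_pow_nine := M.sign_perm M.pow_nine_smul_c (by
    rw [M.pow_nine_smul_root, ← pow_mul, M.pow_root_mod]
    simp only [Units.val_neg, Units.val_one, Int.cast_neg, Int.cast_one]
    linear_combination 2 * pow_eighteen_add M.prim)
  eq_one := fun n hn h ↦ by
    rw [MulAction.mem_stabilizer_iff] at hn
    have hw : ∀ w : R, IsPrimitiveRoot w 27 → ∃ k, w = M.s ^ k • M.ζ := fun w hw ↦ by
      obtain ⟨m, hm, rfl⟩ := M.prim.eq_pow_of_pow_eq_one hw.pow_eq_one
      obtain ⟨k, -, hk⟩ := exists_two_pow_eq m hm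
        ((M.prim.pow_iff_coprime (by norm_num) m).1 hw)
      exact ⟨k, by rw [M.pow_smul_root, M.pow_eq_pow_iff, hk, Nat.mod_eq_of_lt hm]⟩
    refine M.eq_one n (fun w h' ↦ ?_) fun w x h' hx ↦ ?_
    · obtain ⟨k, rfl⟩ := hw w h'
      rw [M.pow_smul_root, smul_pow', hn]
    · obtain ⟨k, rfl⟩ := hw w h'
      have h9 := h (k % 9) (Nat.mod_lt _ (by norm_num))
      rw [← smul_trace, ← c, M.pow_smul_c] at hx
      have hx' := quartic_smul_eq_zero (g := (M.s ^ (k % 9))⁻¹) hx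
      rw [inv_smul_smul] at hx'
      obtain ⟨a, ha⟩ := M.exists_eq_r hx'
      have hc : ((M.s ^ (k % 9))⁻¹ * n * M.s ^ (k % 9)) • M.c = M.c := by
        refine M.smul_c ?_
        rw [mul_smul, mul_smul, M.pow_smul_root, smul_pow', hn, ← M.pow_smul_root, inv_smul_smul]
      have := M.smul_r hc a
      rw [h9, ← ha, mul_smul, smul_inv_smul, mul_smul, inv_smul_eq_iff] at this
      rw [this, Equiv.Perm.one_apply, ← ha, smul_inv_smul]
  exists_pow_mul_mem := fun g ↦ by
    obtain ⟨m, hm, hc, h⟩ := M.exists_smul_eq_pow g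
    obtain ⟨k, -, hk⟩ := exists_two_pow m hm hc
    refine ⟨k, MulAction.mem_stabilizer_iff.2 ?_⟩
    rw [mul_smul, h, M.smul_eq_pow (M.pow_smul_root k)]
    simpa using (M.pow_eq_pow_iff _ 1).2 hk
  pow_mem_iff := fun k ↦ by
    rw [MulAction.mem_stabilizer_iff, M.pow_smul_root, ← two_pow_mod]
    simpa using M.pow_eq_pow_iff (2 ^ k) 1
  frob := φ
  frob_mem := hφ
  frob_sq_ne := h_ne
  frob_sq := h_sq
  frob_ne := hne

end Model

end Action

section CharP

variable {k : Type*} [Field k] {p : ℕ} [Fact p.Prime] [CharP k p]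

/-- Roots of quadratic polynomials over the prime field are fixed by the square of Frobenius. -/
theorem pow_char_pow_char {x : k} {u v : ℤ} (h : x ^ 2 + u * x + v = 0) : (x ^ p) ^ p = x := by
  have h' : (x ^ p) ^ 2 + u * x ^ p + v = 0 := by
    have := congrArg (frobenius k p) h
    rwa [map_add, map_add, map_mul, map_pow, map_intCast, map_intCast, map_zero,
      frobenius_def] at this
  rcases mul_eq_zero.1 (show (x ^ p - x) * (x ^ p + x + u) = 0 by linear_combination h' - h) with
    h1 | h1
  · rw [sub_eq_zero.1 h1, sub_eq_zero.1 h1]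
  · have h2 : x ^ p = -x - u := by linear_combination h1
    have h3 := congrArg (frobenius k p) h2
    rw [map_sub, map_neg, map_intCast, frobenius_def, frobenius_def, h2] at h3
    rw [h2, h3]
    ring

end CharP

theorem intCast_eq_of_emod {k : Type*} [Ring k] {p : ℕ} [CharP k p] {a b : ℤ}
    (h : a % p = b % p) : (a : k) = b :=
  (CharP.intCast_eq_intCast k p).2 h

theorem natCast_eq_of_mod {k : Type*} [Ring k] {p : ℕ} [CharP k p] {a b : ℕ}
    (h : a % p = b) : (a : k) = b := by
  rw [CharP.cast_eq_mod k p a, h]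

theorem pow_sub_one_eq_one {k : Type*} [Field k] {x : k} {n : ℕ} (hn : n ≠ 0) (hx : x ^ n = x)
    (h0 : x ≠ 0) : x ^ (n - 1) = 1 := by
  refine mul_right_cancel₀ h0 ?_
  rw [← pow_succ, Nat.sub_add_cancel (Nat.one_le_iff_ne_zero.2 hn), hx, one_mul]

theorem coeffThree_intCast {k : Type*} [CommRing k] (n : ℤ) :
    coeffThree (n : k) = (coeffThree n : ℤ) := by simp [coeffThree]

theorem coeffTwo_intCast {k : Type*} [CommRing k] (n : ℤ) :
    coeffTwo (n : k) = (coeffTwo n : ℤ) := by simp [coeffTwo]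

theorem coeffOne_intCast {k : Type*} [CommRing k] (n : ℤ) :
    coeffOne (n : k) = (coeffOne n : ℤ) := by simp [coeffOne]

theorem coeffZero_intCast {k : Type*} [CommRing k] (n : ℤ) :
    coeffZero (n : k) = (coeffZero n : ℤ) := by simp [coeffZero]

/-- The rational prime whose Frobenius is used to generate the Galois group. -/
abbrev frobPrime : ℕ := 37423

instance fact_prime_frobPrime : Fact frobPrime.Prime := ⟨by norm_num⟩

section Residue

variable {k : Type*} [Field k] [CharP k frobPrime]

/-- Integers congruent to the conjugates of the trace of the distinguished root of unity. -/
def residueTrace : ℕ → ℤ := fun i ↦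
  [33224, 5366, 15667, 34853, 18450, 2890, 6769, 13607, 18866].getD i 0

theorem exists_factorization : ∀ i : ℕ, 1 ≤ i → i < 9 → ∃ u v u' v' : ℤ,
    coeffThree (residueTrace i) % frobPrime = (u + u') % frobPrime ∧
    coeffTwo (residueTrace i) % frobPrime = (v + v' + u * u') % frobPrime ∧
    coeffOne (residueTrace i) % frobPrime = (u * v' + u' * v) % frobPrime ∧
    coeffZero (residueTrace i) % frobPrime = (v * v') % frobPrime := by
  intro i h1 h9
  interval_cases i
  · exact ⟨6878, 28699, 9977, 34455, by decide +kernel⟩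
  · exact ⟨27170, 36821, 26537, 2190, by decide +kernel⟩
  · exact ⟨4322, 35316, 4869, 25829, by decide +kernel⟩
  · exact ⟨3049, 35659, 3074, 33295, by decide +kernel⟩
  · exact ⟨13120, 32232, 30157, 15933, by decide +kernel⟩
  · exact ⟨26347, 8725, 37214, 10450, by decide +kernel⟩
  · exact ⟨760, 4267, 36978, 30108, by decide +kernel⟩
  · exact ⟨27811, 14524, 31940, 19293, by decide +kernel⟩

theorem quartic_eq_mul {n u v u' v' : ℤ}
    (h3 : coeffThree n % frobPrime = (u + u') % frobPrime)
    (h2 : coeffTwo n % frobPrime = (v + v' + u * u') % frobPrime)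
    (h1 : coeffOne n % frobPrime = (u * v' + u' * v) % frobPrime)
    (h0 : coeffZero n % frobPrime = (v * v') % frobPrime) (x : k) :
    quartic (n : k) x = (x ^ 2 + u * x + v) * (x ^ 2 + u' * x + v') := by
  have e3 := (intCast_eq_of_emod h3 : (_ : k) = _)
  have e2 := (intCast_eq_of_emod h2 : (_ : k) = _)
  have e1 := (intCast_eq_of_emod h1 : (_ : k) = _)
  have e0 := (intCast_eq_of_emod h0 : (_ : k) = _)
  rw [quartic, coeffThree_intCast, coeffTwo_intCast, coeffOne_intCast, coeffZero_intCast,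
    e3, e2, e1, e0]
  push_cast
  ring

theorem pow_pow_eq_of_quartic {i : ℕ} (h1 : 1 ≤ i) (h9 : i < 9) {x : k}
    (hx : quartic (residueTrace i : k) x = 0) : (x ^ frobPrime) ^ frobPrime = x := by
  obtain ⟨u, v, u', v', h3, h2, h1, h0⟩ := exists_factorization i h1 h9
  rw [quartic_eq_mul h3 h2 h1 h0] at hx
  rcases mul_eq_zero.1 hx with h | h
  · exact pow_char_pow_char h
  · exact pow_char_pow_char h

/-- Roots of quadratic polynomials with nonresidual discriminant are moved by Frobenius. -/
theorem pow_ne_of_quadratic {u v : ℤ} {d : ℕ} (hd : (u ^ 2 - 4 * v) % frobPrime = d)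
    (hd' : d ^ 18711 % frobPrime = 37422) {x : k} (hx : x ^ 2 + u * x + v = 0) :
    x ^ frobPrime ≠ x := by
  intro h
  have hmod : (d : ℤ) % frobPrime = d := by rw [← hd, Int.emod_emod_of_dvd _ dvd_rfl]
  have hdk := (intCast_eq_of_emod (hd.trans hmod.symm) : (_ : k) = _)
  have hdk' := (natCast_eq_of_mod hd' : (_ : k) = _)
  push_cast at hdk hdk'
  have hy : (2 * x + u) ^ 2 = (d : k) := by linear_combination 4 * hx + hdk
  have h1 : (1 : k) + 37422 = 0 := by
    have := CharP.cast_eq_zero k frobPrime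
    push_cast at this
    linear_combination this
  have hp : (2 * x + u) ^ frobPrime = 2 * x + u := by
    have : (frobenius k frobPrime) (2 * x + u) = 2 * x + u := by
      rw [map_add, map_mul, map_ofNat, map_intCast, frobenius_def, h]
    exact this
  have h2 : (2 : k) ≠ 0 := by
    intro h2
    have : (1 : k) = 0 := by linear_combination h1 - 18711 * h2
    exact one_ne_zero this
  have h0 : 2 * x + u ≠ 0 := by
    intro h0
    rw [← hy, h0] at hdk'
    have : (1 : k) = 0 := by
      rw [zero_pow two_ne_zero, zero_pow (by norm_num)] at hdk'
      linear_combination h1 + hdk'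
    exact one_ne_zero this
  have key := pow_sub_one_eq_one (by norm_num) hp h0
  rw [show frobPrime - 1 = 2 * 18711 from rfl, pow_mul, hy, hdk'] at key
  exact h2 (by linear_combination h1 - key)

theorem pow_ne_of_quartic {x : k} (hx : quartic (residueTrace 1 : k) x = 0) :
    x ^ frobPrime ≠ x := by
  have h : quartic (residueTrace 1 : k) x =
      (x ^ 2 + (6878 : ℤ) * x + (28699 : ℤ)) * (x ^ 2 + (9977 : ℤ) * x + (34455 : ℤ)) := by
    refine quartic_eq_mul ?_ ?_ ?_ ?_ x <;> decide +kernel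
  rw [h] at hx
  rcases mul_eq_zero.1 hx with h | h
  · exact pow_ne_of_quadratic (d := 1685) (by norm_num) (by decide +kernel) h
  · exact pow_ne_of_quadratic (d := 7221) (by norm_num) (by decide +kernel) h

/-- Roots of a suitable cubic polynomial are moved by the square of Frobenius. -/
theorem pow_pow_ne_of_cubic {b c d m e : ℕ} (hbd : (c ^ 2) % frobPrime = 3 * b * d % frobPrime)
    (hm : (m + 27 * d ^ 2) % frobPrime = c ^ 3 % frobPrime)
    (he : m ^ 12474 % frobPrime = e) (he0 : e % frobPrime ≠ 0)
    (he1 : (e ^ 37424) % frobPrime ≠ 1) {h : k} (h0 : h ≠ 0)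
    (hh : h ^ 3 + b * h ^ 2 + c * h + d = 0) : (h ^ frobPrime) ^ frobPrime ≠ h := by
  intro hp
  have hbd' : (c : k) ^ 2 = 3 * b * d := by
    exact_mod_cast (CharP.natCast_eq_natCast k frobPrime).2 hbd
  have hm' : (m : k) + 27 * d ^ 2 = c ^ 3 := by
    exact_mod_cast (CharP.natCast_eq_natCast k frobPrime).2 hm
  have he' : (m : k) ^ 12474 = e := by exact_mod_cast (natCast_eq_of_mod he : (_ : k) = _)
  have hcube : (3 * d + c * h) ^ 3 = (m : k) * h ^ 3 := by
    linear_combination 27 * d ^ 2 * hh + 9 * d * h ^ 2 * hbd' - h ^ 3 * hm'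
  have hek : (e : k) ≠ 0 := fun h1 ↦ he0 (by
    rwa [CharP.cast_eq_zero_iff k frobPrime, Nat.dvd_iff_mod_eq_zero] at h1)
  have hek1 : (e : k) ^ 37424 ≠ 1 := fun h1 ↦ he1 (by
    have h2 : ((e ^ 37424 : ℕ) : k) = (1 : ℕ) := by exact_mod_cast h1
    exact (CharP.natCast_eq_natCast k frobPrime).1 h2)
  have hw0 : 3 * d + c * h ≠ 0 := by
    intro hw
    rw [hw, zero_pow three_ne_zero, eq_comm, mul_eq_zero] at hcube
    rcases hcube with h1 | h1
    · rw [h1, zero_pow (by norm_num)] at he'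
      exact hek he'.symm
    · exact h0 (pow_eq_zero_iff three_ne_zero |>.1 h1)
  have hw : ((3 * d + c * h) ^ frobPrime) ^ frobPrime = 3 * d + c * h := by
    have : (frobenius k frobPrime) ((frobenius k frobPrime) (3 * d + c * h)) = 3 * d + c * h := by
      simp only [map_add, map_mul, map_natCast, map_ofNat, frobenius_def, hp]
    exact this
  have hexp : frobPrime * frobPrime - 1 = 3 * (12474 * 37424) := by norm_num
  rw [← pow_mul] at hp hw
  have h1 := pow_sub_one_eq_one (by norm_num) hp h0
  have h2 := pow_sub_one_eq_one (by norm_num) hw hw0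
  rw [hexp, pow_mul] at h1 h2
  rw [hcube, mul_pow, h1, mul_one, pow_mul, he'] at h2
  exact hek1 h2

theorem pow_pow_ne_of_quartic {x : k} (hx : quartic (residueTrace 0 : k) x = 0)
    (hne : x ≠ (9797 : ℤ)) : (x ^ frobPrime) ^ frobPrime ≠ x := by
  have e3 := intCast_eq_of_emod (k := k) (p := frobPrime) (a := coeffThree (residueTrace 0))
    (b := 10955 - 4 * 9797) (by decide +kernel)
  have e2 := intCast_eq_of_emod (k := k) (p := frobPrime) (a := coeffTwo (residueTrace 0))
    (b := 6 * 9797 ^ 2 - 3 * 10955 * 9797 + 23912) (by decide +kernel)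
  have e1 := intCast_eq_of_emod (k := k) (p := frobPrime) (a := coeffOne (residueTrace 0))
    (b := -4 * 9797 ^ 3 + 3 * 10955 * 9797 ^ 2 - 2 * 23912 * 9797 + 22029) (by decide +kernel)
  have e0 := intCast_eq_of_emod (k := k) (p := frobPrime) (a := coeffZero (residueTrace 0))
    (b := 9797 ^ 4 - 10955 * 9797 ^ 3 + 23912 * 9797 ^ 2 - 22029 * 9797) (by decide +kernel)
  rw [← coeffThree_intCast] at e3
  rw [← coeffTwo_intCast] at e2
  rw [← coeffOne_intCast] at e1
  rw [← coeffZero_intCast] at e0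
  rw [quartic, e3, e2, e1, e0] at hx
  have h0 : x - (9797 : ℤ) ≠ 0 := sub_ne_zero.2 hne
  have hcub : (x - (9797 : ℤ)) ^ 3 + (10955 : ℕ) * (x - (9797 : ℤ)) ^ 2
      + (23912 : ℕ) * (x - (9797 : ℤ)) + (22029 : ℕ) = 0 := by
    refine (mul_eq_zero.1 ((?_ : (x - (9797 : ℤ)) * _ = 0))).resolve_left h0
    push_cast at hx ⊢
    linear_combination hx
  have key := pow_pow_ne_of_cubic (m := 14850) (e := 36536) (by norm_num) (by norm_num)
    (by decide +kernel) (by norm_num) (by decide +kernel) h0 hcub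
  intro h
  apply key
  have : (frobenius k frobPrime) ((frobenius k frobPrime) (x - (9797 : ℤ))) =
      x - (9797 : ℤ) := by
    rw [map_sub, map_sub, map_intCast, map_intCast, frobenius_def, frobenius_def, h]
  exact this

end Residue

namespace Model

section Frobenius

variable {R G k : Type*} [CommRing R] [IsDomain R] [CharZero R] [Group G] [MulSemiringAction G R]
  [Field k] [CharP k frobPrime] (M : Model G R) (π : R →+* k)

theorem three_notMem_ker {R k : Type*} [CommRing R] [Field k] [CharP k frobPrime] (π : R →+* k) :
    (3 : R) ∉ RingHom.ker π := by
  rw [RingHom.mem_ker, map_ofNat]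
  intro h
  have := (CharP.cast_eq_zero_iff k frobPrime 3).1 (by exact_mod_cast h)
  norm_num at this

theorem map_pow_smul_c (hz : π M.ζ = (25696 : ℕ)) {i : ℕ} (hi : i < 9) :
    π (M.s ^ i • M.c) = (residueTrace i : k) := by
  have h : π (M.s ^ i • M.c) = ((25696 ^ 2 ^ i + (25696 ^ 2 ^ i) ^ 26 : ℕ) : k) := by
    rw [c, smul_trace, M.pow_smul_root, trace, map_add, map_pow, map_pow, map_pow, hz]
    push_cast
    rfl
  rw [h]
  have key : ∀ i < 9,
      ((25696 ^ 2 ^ i + (25696 ^ 2 ^ i) ^ 26) % frobPrime : ℕ) = residueTrace i := by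
    decide +kernel
  rw [CharP.cast_eq_mod k frobPrime, ← key i hi, Int.cast_natCast]

theorem quartic_map (hz : π M.ζ = (25696 : ℕ)) {i : ℕ} (hi : i < 9) (a : Fin 4) :
    quartic (residueTrace i : k) (π (M.s ^ i • M.r a)) = 0 := by
  rw [← M.map_pow_smul_c π hz hi, ← map_quartic, ← smul_quartic, M.quartic_r, smul_zero, map_zero]

theorem map_pow_smul_injective (i : ℕ) : Function.Injective fun a ↦ π (M.s ^ i • M.r a) := by
  intro a b hab
  have := RingHom.ker_isPrime π
  refine M.family.eq_of_sub_mem (minCos_trace M.prim)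
    ((RingHom.ker π).comap (MulSemiringAction.toRingHom G R (M.s ^ i))) (fun h ↦ ?_) ?_
  · rw [Ideal.mem_comap, map_ofNat] at h
    exact three_notMem_ker π h
  · rw [Ideal.mem_comap, MulSemiringAction.toRingHom_apply, RingHom.mem_ker, smul_sub, map_sub]
    exact sub_eq_zero.2 hab

theorem frob_smul_root {φ : G} (hφ : ∀ x, π (φ • x) = π x ^ frobPrime)
    (hz : π M.ζ = (25696 : ℕ)) : φ • M.ζ = M.ζ := by
  have := RingHom.ker_isPrime π
  refine pow_eq_of_sub_mem (by rw [← smul_pow', M.prim.pow_eq_one, smul_one]) M.prim.pow_eq_one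
    (RingHom.ker π) (three_notMem_ker π) ?_
  rw [RingHom.mem_ker, map_sub, hφ, hz, sub_eq_zero]
  exact map_natCast (frobenius k frobPrime) _

theorem map_pow_smul_perm {φ : G} (hφ : ∀ x, π (φ • x) = π x ^ frobPrime)
    (hz : π M.ζ = (25696 : ℕ)) (i : ℕ) (a : Fin 4) :
    π (M.s ^ i • M.r (M.perm ((M.s ^ i)⁻¹ * φ * M.s ^ i) a)) = π (M.s ^ i • M.r a) ^ frobPrime := by
  have hc : ((M.s ^ i)⁻¹ * φ * M.s ^ i) • M.c = M.c := by
    refine M.smul_c ?_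
    rw [mul_smul, mul_smul, M.pow_smul_root, smul_pow', M.frob_smul_root π hφ hz,
      ← M.pow_smul_root, inv_smul_smul]
  rw [← M.smul_r hc, mul_smul, mul_smul, smul_inv_smul, hφ]

theorem map_pow_smul_perm_sq {φ : G} (hφ : ∀ x, π (φ • x) = π x ^ frobPrime)
    (hz : π M.ζ = (25696 : ℕ)) (i : ℕ) (a : Fin 4) :
    π (M.s ^ i • M.r ((M.perm ((M.s ^ i)⁻¹ * φ * M.s ^ i) ^ 2) a)) =
      (π (M.s ^ i • M.r a) ^ frobPrime) ^ frobPrime := by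
  rw [sq, Equiv.Perm.mul_apply, M.map_pow_smul_perm π hφ hz, M.map_pow_smul_perm π hφ hz]

theorem perm_conj_sq {φ : G} (hφ : ∀ x, π (φ • x) = π x ^ frobPrime)
    (hz : π M.ζ = (25696 : ℕ)) {i : ℕ} (h1 : 1 ≤ i) (h9 : i < 9) :
    M.perm ((M.s ^ i)⁻¹ * φ * M.s ^ i) ^ 2 = 1 := by
  ext1 a
  apply M.map_pow_smul_injective π i
  dsimp only
  rw [M.map_pow_smul_perm_sq π hφ hz,
    pow_pow_eq_of_quartic h1 h9 (M.quartic_map π hz h9 a), Equiv.Perm.one_apply]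

theorem perm_conj_ne {φ : G} (hφ : ∀ x, π (φ • x) = π x ^ frobPrime)
    (hz : π M.ζ = (25696 : ℕ)) : M.perm ((M.s ^ 1)⁻¹ * φ * M.s ^ 1) ≠ 1 := by
  intro h
  have := M.map_pow_smul_perm π hφ hz 1 0
  rw [h, Equiv.Perm.one_apply] at this
  exact pow_ne_of_quartic (M.quartic_map π hz (by norm_num) 0) this.symm

theorem perm_sq_ne {φ : G} (hφ : ∀ x, π (φ • x) = π x ^ frobPrime)
    (hz : π M.ζ = (25696 : ℕ)) : M.perm φ ^ 2 ≠ 1 := by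
  intro h
  have h' : ∀ a, π (M.r a) = (9797 : ℤ) := fun a ↦ by
    by_contra hne
    have h1 := M.map_pow_smul_perm_sq π hφ hz 0 a
    have h2 := M.quartic_map π hz (i := 0) (by norm_num) a
    simp only [pow_zero, inv_one, one_mul, mul_one, one_smul] at h1 h2
    rw [h, Equiv.Perm.one_apply] at h1
    exact pow_pow_ne_of_quartic h2 hne h1.symm
  have := M.map_pow_smul_injective π 0 (a₁ := 0) (a₂ := 1) (by
    simp only [pow_zero, one_smul, h'])
  simp at this

/-- The fiber action attached to a model and a Frobenius element. -/
noncomputable def fiberActionOfFrob {φ : G} (hφ : ∀ x, π (φ • x) = π x ^ frobPrime)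
    (hz : π M.ζ = (25696 : ℕ)) : FiberAction G :=
  M.fiberAction φ (M.frob_smul_root π hφ hz) (M.perm_sq_ne π hφ hz)
    (fun _ h1 h9 ↦ M.perm_conj_sq π hφ hz h1 h9)
    ⟨1, le_rfl, by norm_num, M.perm_conj_ne π hφ hz⟩

end Frobenius

end Model

end CyclicQuartic

open NumberField in
/-- A prime whose inertia groups are all trivial does not divide the discriminant. -/
theorem NumberField.not_dvd_discr_of_inertia_eq_bot (K : Type*) [Field K] [NumberField K]
    [IsGalois ℚ K] {q : ℕ} (hq : q.Prime)
    (h : ∀ Q : Ideal (𝓞 K), Q.IsPrime → (q : 𝓞 K) ∈ Q → Q.inertia (K ≃ₐ[ℚ] K) = ⊥) :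
    ¬ q ∣ (discr K).natAbs := by
  have hq' : Prime (q : ℤ) := Nat.prime_iff_prime_int.mp hq
  rw [← Int.natCast_dvd]
  rw [NumberField.not_dvd_discr_iff_forall_liesOver K (𝓞 K) hq']
  intro P hP hPl
  have hPp := hP.isPrime
  have hI := h P hPp (by
    have := (Ideal.liesOver_span_iff hPp.ne_top hq').mp hPl
    simpa using this)
  have : (Ideal.span {(q : ℤ)}).IsPrime := by
    rw [Ideal.span_singleton_prime hq'.ne_zero]; exact hq'
  have : (Ideal.span {(q : ℤ)}).IsMaximal :=
    this.isMaximal (by simpa using hq.ne_zero)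
  have : Finite (ℤ ⧸ Ideal.span {(q : ℤ)}) :=
    Ideal.finiteQuotientOfFreeOfNeBot _ (by simpa using hq.ne_zero)
  have hfin : Finite (Ideal.span {(q : ℤ)}).ResidueField := inferInstance
  have := Ideal.card_inertia_eq_ramificationIdxIn (G := K ≃ₐ[ℚ] K) (Ideal.span {(q : ℤ)}) P
  rw [hI, Ideal.ramificationIdxIn_eq_ramificationIdx (Ideal.span {(q : ℤ)}) P (K ≃ₐ[ℚ] K)] at this
  rw [← Ideal.ramificationIdx_eq_one_iff]
  simpa using this.symm

namespace CyclicQuartic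

/-- Roots of the quartic in the field of fractions of an integrally closed domain are integral. -/
theorem exists_algebraMap_eq {R F : Type*} [CommRing R] [IsDomain R] [IsIntegrallyClosed R]
    [Field F] [Algebra R F] [IsFractionRing R F] {c : R} {x : F}
    (hx : quartic (algebraMap R F c) x = 0) : ∃ y, algebraMap R F y = x := by
  refine IsIntegrallyClosed.isIntegral_iff.1 ⟨Polynomial.X ^ 4 +
    Polynomial.C (coeffThree c) * Polynomial.X ^ 3 + Polynomial.C (coeffTwo c) * Polynomial.X ^ 2 +
    Polynomial.C (coeffOne c) * Polynomial.X + Polynomial.C (coeffZero c), ?_, ?_⟩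
  · monicity!
  · rw [← hx]
    simp [quartic, coeffThree, coeffTwo, coeffOne, coeffZero, map_ofNat]

theorem isRootFamily_of_map {R S : Type*} [CommRing R] [CommRing S] {f : R →+* S}
    (hf : Function.Injective f) {c : R} {r : Fin 4 → R} (h : IsRootFamily (f c) (f ∘ r)) :
    IsRootFamily c r := by
  obtain ⟨h3, h2, h1, h0⟩ := h
  refine ⟨hf ?_, hf ?_, hf ?_, hf ?_⟩
  · simpa [coeffThree, map_ofNat] using h3
  · simpa [coeffTwo, map_ofNat] using h2
  · simpa [coeffOne, map_ofNat] using h1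
  · simpa [coeffZero, map_ofNat] using h0

open NumberField

variable {K : Type*} [Field K] [NumberField K]

theorem exists_isRootFamily_ringOfIntegers {w : 𝓞 K}
    (h : ∃ r, IsRootFamily (trace (w : K)) r) : ∃ r : Fin 4 → 𝓞 K, IsRootFamily (trace w) r := by
  obtain ⟨r, hr⟩ := h
  have hw : algebraMap (𝓞 K) K (trace w) = trace (w : K) := by simp [trace]
  rw [← hw] at hr
  choose r' hr' using fun a ↦ exists_algebraMap_eq (hr.quartic_apply a)
  refine ⟨r', isRootFamily_of_map (f := algebraMap (𝓞 K) K) (RingOfIntegers.coe_injective) ?_⟩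
  rwa [show algebraMap (𝓞 K) K ∘ r' = r from funext hr']

theorem exists_algEquiv_apply_eq_sq [IsGalois ℚ K] {w : K} (hw : IsPrimitiveRoot w 27) :
    ∃ s : K ≃ₐ[ℚ] K, s w = w ^ 2 := by
  have h2 := hw.pow_of_coprime 2 (by norm_num)
  have h : IsConjRoot ℚ (w ^ 2) w := by
    rw [isConjRoot_def, ← Polynomial.cyclotomic_eq_minpoly_rat h2 (by norm_num),
      ← Polynomial.cyclotomic_eq_minpoly_rat hw (by norm_num)]
  obtain ⟨s, hs⟩ := isConjRoot_iff_exists_algEquiv.1 h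
  exact ⟨s, hs⟩

/-- The field `K` is generated by the roots of the quartics attached to the traces of the
primitive `27`-th roots of unity and these roots of unity. -/
structure IsSplittingField (K : Type*) [Field K] [CharZero K] : Prop where
  exists_root : ∃ w : K, IsPrimitiveRoot w 27
  exists_family : ∀ w : K, IsPrimitiveRoot w 27 → ∃ r, IsRootFamily (trace w) r
  eq_one : ∀ g : K ≃ₐ[ℚ] K, (∀ w, IsPrimitiveRoot w 27 → g w = w) →
    (∀ w x, IsPrimitiveRoot w 27 → quartic (trace w) x = 0 → g x = x) → g = 1

theorem coe_isPrimitiveRoot {K : Type*} [Field K] {w : 𝓞 K} (hw : IsPrimitiveRoot w 27) :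
    IsPrimitiveRoot (w : K) 27 :=
  hw.map_of_injective (f := algebraMap (𝓞 K) K) RingOfIntegers.coe_injective

theorem IsSplittingField.ringOfIntegers_eq_one (h : IsSplittingField K) {g : K ≃ₐ[ℚ] K}
    (hg : ∀ w : 𝓞 K, IsPrimitiveRoot w 27 → g • w = w)
    (hg' : ∀ w x : 𝓞 K, IsPrimitiveRoot w 27 → quartic (trace w) x = 0 → g • x = x) :
    g = 1 := by
  have hint : ∀ w : K, IsPrimitiveRoot w 27 → ∃ w' : 𝓞 K, IsPrimitiveRoot w' 27 ∧ w' = w :=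
    fun w hw ↦ ⟨hw.toInteger, hw.toInteger_isPrimitiveRoot, rfl⟩
  have hcoe : ∀ x : 𝓞 K, g • x = x → g (x : K) = x := fun x hx ↦
    congrArg (algebraMap (𝓞 K) K) hx
  refine h.eq_one g (fun w hw ↦ ?_) fun w x hw hx ↦ ?_
  · obtain ⟨w, hw', rfl⟩ := hint w hw
    exact hcoe w (hg w hw')
  · obtain ⟨w, hw', rfl⟩ := hint w hw
    have ht : trace (w : K) = algebraMap (𝓞 K) K (trace w) := by simp [trace]
    rw [ht] at hx
    obtain ⟨x, rfl⟩ := exists_algebraMap_eq hx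
    rw [← map_quartic] at hx
    exact hcoe x (hg' w x hw' (RingOfIntegers.coe_injective (hx.trans (map_zero _).symm)))

/-- The model provided by a splitting field and a primitive root of unity. -/
theorem IsSplittingField.exists_model [IsGalois ℚ K] (h : IsSplittingField K) {w : 𝓞 K}
    (hw : IsPrimitiveRoot w 27) : ∃ M : Model (K ≃ₐ[ℚ] K) (𝓞 K), M.ζ = w := by
  obtain ⟨s, hs⟩ := exists_algEquiv_apply_eq_sq (coe_isPrimitiveRoot hw)
  obtain ⟨r, hr⟩ := exists_isRootFamily_ringOfIntegers (h.exists_family w (coe_isPrimitiveRoot hw))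
  exact ⟨⟨w, hw, s, RingOfIntegers.coe_injective (by rw [map_pow]; exact hs), r, hr,
    fun g ↦ h.ringOfIntegers_eq_one⟩, rfl⟩

theorem IsSplittingField.inertia_eq_bot (h : IsSplittingField K) (Q : Ideal (𝓞 K)) [Q.IsPrime]
    (hQ : (3 : 𝓞 K) ∉ Q) : Q.inertia (K ≃ₐ[ℚ] K) = ⊥ := by
  rw [eq_bot_iff]
  intro g hg
  rw [Subgroup.mem_bot]
  have hg' : ∀ x : 𝓞 K, g • x - x ∈ Q := hg
  have hroot : ∀ w : 𝓞 K, IsPrimitiveRoot w 27 → g • w = w := fun w hw ↦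
    pow_eq_of_sub_mem (by rw [← smul_pow', hw.pow_eq_one, smul_one]) hw.pow_eq_one Q hQ (hg' w)
  refine h.ringOfIntegers_eq_one hroot fun w x hw hx ↦ ?_
  obtain ⟨r, hr⟩ := exists_isRootFamily_ringOfIntegers (h.exists_family w (coe_isPrimitiveRoot hw))
  have hx' := quartic_smul_eq_zero (g := g) hx
  rw [smul_trace, hroot w hw] at hx'
  obtain ⟨a, ha⟩ := hr.exists_eq hx'
  obtain ⟨b, rfl⟩ := hr.exists_eq hx
  have hab := hg' (r b)
  rw [ha] at hab
  rw [ha, hr.eq_of_sub_mem (minCos_trace hw) Q hQ hab]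

theorem IsSplittingField.eq_three_of_dvd_discr [IsGalois ℚ K] (h : IsSplittingField K) {q : ℕ}
    (hq : q.Prime) (hd : q ∣ (discr K).natAbs) : q = 3 := by
  by_contra hne
  refine not_dvd_discr_of_inertia_eq_bot K hq (fun Q hQ hqQ ↦ h.inertia_eq_bot Q fun h3 ↦ ?_) hd
  have hco : IsCoprime (q : ℤ) (3 : ℕ) :=
    Nat.isCoprime_iff_coprime.2 ((Nat.coprime_primes hq Nat.prime_three).2 hne)
  obtain ⟨a, b, hab⟩ := hco
  refine hQ.ne_top ((Ideal.eq_top_iff_one Q).2 ?_)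
  have h1 := Q.add_mem (Q.mul_mem_left (a : 𝓞 K) hqQ) (Q.mul_mem_left (b : 𝓞 K) h3)
  have h2 : ((a * q + b * (3 : ℕ) : ℤ) : 𝓞 K) = 1 := by rw [hab, Int.cast_one]
  push_cast at h2
  rwa [h2] at h1

theorem exists_isPrimitiveRoot_sub_mem {R : Type*} [CommRing R] [IsDomain R]
    (hw : ∃ w : R, IsPrimitiveRoot w 27) (Q : Ideal R) [Q.IsPrime] {n : R}
    (hn : n ^ 27 - 1 ∈ Q) (hn' : n ^ 9 - 1 ∉ Q) : ∃ w : R, IsPrimitiveRoot w 27 ∧ n - w ∈ Q := by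
  obtain ⟨w, hw⟩ := hw
  have h := congrArg (Polynomial.eval n) (Polynomial.X_pow_sub_one_eq_prod (by norm_num) hw)
  rw [Polynomial.eval_prod] at h
  simp only [Polynomial.eval_sub, Polynomial.eval_pow, Polynomial.eval_X, Polynomial.eval_one,
    Polynomial.eval_C] at h
  rw [h, Ideal.IsPrime.prod_mem_iff] at hn
  obtain ⟨v, hv, hvQ⟩ := hn
  refine ⟨v, ?_, hvQ⟩
  have hv1 : v ^ 3 ^ (2 + 1) = 1 := (Polynomial.mem_nthRootsFinset (by norm_num) 1).1 hv
  rw [IsPrimitiveRoot.iff_orderOf]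
  refine (orderOf_eq_prime_pow (p := 3) (n := 2) (fun hv9 ↦ hn' ?_) hv1).trans rfl
  have hv9' : v ^ 9 = 1 := hv9
  rw [← hv9']
  exact Ideal.mem_of_dvd Q (sub_dvd_pow_sub_pow n v 9) hvQ

theorem IsSplittingField.nonempty_fiberAction [IsGalois ℚ K] (h : IsSplittingField K) :
    Nonempty (FiberAction (K ≃ₐ[ℚ] K)) := by
  have hp : Prime (frobPrime : ℤ) := Nat.prime_iff_prime_int.1 Fact.out
  have : (Ideal.span {(frobPrime : ℤ)}).IsPrime := by
    rw [Ideal.span_singleton_prime hp.ne_zero]; exact hp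
  obtain ⟨⟨Q, hQp, hQl⟩⟩ := (inferInstance : Nonempty
    (Ideal.primesOver (Ideal.span {(frobPrime : ℤ)}) (𝓞 K)))
  have hpQ : (frobPrime : 𝓞 K) ∈ Q := by
    simpa using (Ideal.liesOver_span_iff hQp.ne_top hp).1 hQl
  have hQ0 : Q ≠ ⊥ := by
    rintro rfl
    rw [Ideal.mem_bot, Nat.cast_eq_zero] at hpQ
    norm_num at hpQ
  have hmax : Q.IsMaximal := hQp.isMaximal hQ0
  have : Finite (𝓞 K ⧸ Q) := Ideal.finiteQuotientOfFreeOfNeBot Q hQ0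
  obtain ⟨φ, hφ⟩ := IsArithFrobAt.exists_of_isInvariant (R := ℤ) (G := K ≃ₐ[ℚ] K) (Q := Q)
  have hcard : Nat.card (ℤ ⧸ Q.under ℤ) = frobPrime := by
    rw [← hQl.over, Nat.card_congr (Int.quotientSpanNatEquivZMod frobPrime).toEquiv, Nat.card_zmod]
  let := Ideal.Quotient.field Q
  have : CharP (𝓞 K ⧸ Q) frobPrime := (CharP.charP_iff_prime_eq_zero Fact.out).2 (by
    rw [← map_natCast (Ideal.Quotient.mk Q), Ideal.Quotient.eq_zero_iff_mem]; exact hpQ)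
  have hmem : ∀ m : ℕ, (m : 𝓞 K) - 1 ∈ Q ↔ m % frobPrime = 1 := fun m ↦ by
    rw [← Ideal.Quotient.eq, map_natCast, map_one, ← Nat.cast_one,
      CharP.natCast_eq_natCast (𝓞 K ⧸ Q) frobPrime]
    rfl
  obtain ⟨w, hw⟩ := h.exists_root
  obtain ⟨w, hw, hwQ⟩ := exists_isPrimitiveRoot_sub_mem ⟨_, hw.toInteger_isPrimitiveRoot⟩ Q
    (n := (25696 : ℕ)) (by rw [← Nat.cast_pow, hmem]; decide +kernel)
    (by rw [← Nat.cast_pow, hmem]; decide +kernel)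
  obtain ⟨M, rfl⟩ := h.exists_model hw
  refine ⟨M.fiberActionOfFrob (k := 𝓞 K ⧸ Q) (Ideal.Quotient.mk Q) (φ := φ) (fun x ↦ ?_) ?_⟩
  · rw [← hcard]
    exact hφ.mk_apply x
  · rw [← map_natCast (Ideal.Quotient.mk Q)]
    exact (Ideal.Quotient.eq.2 hwQ).symm

theorem exists_isRootFamily {F : Type*} [Field F] [IsAlgClosed F] (c : F) :
    ∃ r, IsRootFamily c r := by
  obtain ⟨x, hx⟩ := IsAlgClosed.exists_root (Polynomial.X ^ 4 +
    Polynomial.C (coeffThree c) * Polynomial.X ^ 3 + Polynomial.C (coeffTwo c) * Polynomial.X ^ 2 +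
    Polynomial.C (coeffOne c) * Polynomial.X + Polynomial.C (coeffZero c)) (by
      refine ne_of_eq_of_ne (b := 4) ?_ (by norm_num); compute_degree!)
  obtain ⟨y, hy⟩ := IsAlgClosed.exists_root (Polynomial.X ^ 3 +
    Polynomial.C (coeffThree c + x) * Polynomial.X ^ 2 +
    Polynomial.C (coeffTwo c + x * (coeffThree c + x)) * Polynomial.X +
    Polynomial.C (coeffOne c + x * (coeffTwo c + x * (coeffThree c + x)))) (by
      refine ne_of_eq_of_ne (b := 3) ?_ (by norm_num); compute_degree!)
  obtain ⟨z, hz⟩ := IsAlgClosed.exists_root (Polynomial.X ^ 2 +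
    Polynomial.C (coeffThree c + x + y) * Polynomial.X +
    Polynomial.C (coeffTwo c + x * (coeffThree c + x) + y * (coeffThree c + x + y))) (by
      refine ne_of_eq_of_ne (b := 2) ?_ (by norm_num); compute_degree!)
  simp only [Polynomial.IsRoot, Polynomial.eval_add, Polynomial.eval_mul, Polynomial.eval_pow,
    Polynomial.eval_X, Polynomial.eval_C] at hx hy hz
  refine ⟨![x, y, z, -coeffThree c - x - y - z], ?_, ?_, ?_, ?_⟩ <;>
    simp only [Matrix.cons_val]
  · ring
  · linear_combination hz
  · linear_combination hy - (x + y) * hz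
  · linear_combination hx - x * hy + x * y * hz

/-- The primitive `27`-th roots of unity and the roots of the quartics attached to their traces. -/
def generators (F : Type*) [Field F] : Set F :=
  {x | IsPrimitiveRoot x 27 ∨ ∃ w, IsPrimitiveRoot w 27 ∧ quartic (trace w) x = 0}

theorem finite_generators (F : Type*) [Field F] [IsAlgClosed F] : (generators F).Finite := by
  have h : {w : F | IsPrimitiveRoot w 27}.Finite :=
    (primitiveRoots 27 F).finite_toSet.subset fun w hw ↦
      (mem_primitiveRoots (by norm_num)).2 hw
  have h' : ∀ c : F, {x | quartic c x = 0}.Finite := fun c ↦ by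
    obtain ⟨r, hr⟩ := exists_isRootFamily c
    refine (Set.finite_range r).subset fun x hx ↦ ?_
    obtain ⟨a, rfl⟩ := hr.exists_eq hx
    exact ⟨a, rfl⟩
  refine (h.union (h.biUnion fun w _ ↦ h' (trace w))).subset ?_
  rintro x (hx | ⟨w, hw, hx⟩)
  · exact Or.inl hx
  · exact Or.inr (Set.mem_biUnion hw hx)

theorem map_trace {R S : Type*} [CommRing R] [CommRing S] (f : R →+* S) (w : R) :
    f (trace w) = trace (f w) := by
  simp [trace]

theorem map_mem_generators {F E : Type*} [Field F] [Field E] (f : F →+* E) {x : F}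
    (hx : x ∈ generators F) : f x ∈ generators E := by
  rcases hx with hx | ⟨w, hw, hx⟩
  · exact Or.inl (hx.map_of_injective f.injective)
  · exact Or.inr ⟨f w, hw.map_of_injective f.injective, by
      rw [← map_trace, ← map_quartic, hx, map_zero]⟩

instance isAlgClosure_rat : IsAlgClosure ℚ (AlgebraicClosure ℚ) where
  isAlgClosed := inferInstance
  isAlgebraic := by
    convert AlgebraicClosure.isAlgebraic ℚ
    · rfl
    · exact Subsingleton.elim (α := Algebra ℚ (AlgebraicClosure ℚ)) _ _

/-- The field generated over `ℚ` by the roots of the quartics. -/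
noncomputable def splittingField : IntermediateField ℚ (AlgebraicClosure ℚ) :=
  IntermediateField.adjoin ℚ (generators (AlgebraicClosure ℚ))

instance : NumberField splittingField where
  to_finiteDimensional := by
    have := IsAlgClosure.isAlgebraic (R := ℚ) (K := AlgebraicClosure ℚ)
    have := (finite_generators (AlgebraicClosure ℚ)).to_subtype
    exact IntermediateField.finiteDimensional_adjoin fun x _ ↦ Algebra.IsIntegral.isIntegral x

instance : IsGalois ℚ splittingField where
  to_normal := by
    have := IsAlgClosure.normal ℚ (AlgebraicClosure ℚ)
    refine IntermediateField.normal_iff_forall_map_le.2 fun σ ↦ ?_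
    rw [splittingField, IntermediateField.adjoin_map]
    refine IntermediateField.adjoin.mono _ _ _ ?_
    rintro _ ⟨x, hx, rfl⟩
    exact map_mem_generators (σ : AlgebraicClosure ℚ →+* AlgebraicClosure ℚ) hx

theorem mem_splittingField {x : AlgebraicClosure ℚ} (hx : x ∈ generators (AlgebraicClosure ℚ)) :
    x ∈ splittingField :=
  IntermediateField.subset_adjoin _ _ hx

theorem isSplittingField_splittingField : IsSplittingField splittingField where
  exists_root := by
    obtain ⟨w, hw⟩ := HasEnoughRootsOfUnity.exists_primitiveRoot (AlgebraicClosure ℚ) 27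
    exact ⟨⟨w, mem_splittingField (Or.inl hw)⟩, IsPrimitiveRoot.coe_submonoidClass_iff.1 hw⟩
  exists_family := fun w hw ↦ by
    have hw' := hw.map_of_injective (f := algebraMap splittingField (AlgebraicClosure ℚ))
      (algebraMap splittingField (AlgebraicClosure ℚ)).injective
    obtain ⟨r, hr⟩ := exists_isRootFamily (trace (algebraMap splittingField (AlgebraicClosure ℚ) w))
    refine ⟨fun a ↦ ⟨r a, mem_splittingField (Or.inr ⟨_, hw', hr.quartic_apply a⟩)⟩, ?_⟩
    refine isRootFamily_of_map (algebraMap splittingField (AlgebraicClosure ℚ)).injective ?_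
    rw [map_trace]
    exact hr
  eq_one := fun g hg hg' ↦ by
    have hext : (g : splittingField →ₐ[ℚ] splittingField) = AlgHom.id ℚ splittingField := by
      refine IntermediateField.algHom_ext_of_eq_adjoin _ rfl fun x hx ↦ ?_
      rcases hx with hx | ⟨w, hw, hx⟩
      · exact hg _ (IsPrimitiveRoot.coe_submonoidClass_iff.1 hx)
      · refine hg' ⟨w, mem_splittingField (Or.inl hw)⟩ _
          (IsPrimitiveRoot.coe_submonoidClass_iff.1 hw) ?_
        apply (algebraMap splittingField (AlgebraicClosure ℚ)).injective
        refine (map_quartic _ _ _).trans ?_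
        rw [map_trace, map_zero]
        exact hx
    exact AlgEquiv.ext fun x ↦ DFunLike.congr_fun hext x

end CyclicQuartic

/-- There is a finite Galois extension `K` of `ℚ`, ramified only at `3`, with Galois group
isomorphic to `(PSL₂(F₃))⁹ ⋊ ℤ/18ℤ` for some action of `ℤ/18ℤ` on the product of `9` copies of
`PSL₂(F₃)`; this group is solvable. -/
theorem solvable_field_ramified_only_at_three :
    ∃ (K : Type) (_ : Field K) (_ : NumberField K) (_ : IsGalois ℚ K),
      (∀ q : ℕ, q.Prime → q ∣ (NumberField.discr K).natAbs → q = 3) ∧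
      (∃ φ : Multiplicative (ZMod 18) →* MulAut (Fin 9 → PSL2 (ZMod 3)),
        Nonempty ((K ≃ₐ[ℚ] K) ≃*
          SemidirectProduct (Fin 9 → PSL2 (ZMod 3)) (Multiplicative (ZMod 18)) φ)) ∧
      IsSolvable (K ≃ₐ[ℚ] K) := by
  obtain ⟨F⟩ := CyclicQuartic.isSplittingField_splittingField.nonempty_fiberAction
  exact ⟨CyclicQuartic.splittingField, inferInstance, inferInstance, inferInstance,
    fun _ ↦ CyclicQuartic.isSplittingField_splittingField.eq_three_of_dvd_discr,
    F.exists_mulEquiv_semidirectProduct PSLTwoThree.equivAlternating, F.isSolvable⟩
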